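/- arXiv:2106.11080 — 3 statements merged into one kernel-verified Lean document; each statement's English description precedes it below -/
import Mathlib

section
/- Let q be odd and 1 ≤ 2r ≤ m. Then v₊(2r,m) − v₋(2r,m) = q^{−r} · s(2r,m), where v₊, v₋ count hyperbolic and elliptic symmetric matrices of rank 2r, and s(2r,m) is the total number of symmetric m×m matrices of rank 2r over F_q. -/
open Matrix

/-- Two square matrices define equivalent quadratic forms if one form is obtained from the
other by an invertible linear change of variables. -/
def QuadEquiv {F : Type*} [Field F] {n : ℕ} (A B : Matrix (Fin n) (Fin n) F) : Prop :=
  ∃ L : Matrix (Fin n) (Fin n) F, IsUnit L.det ∧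
    ∀ X : Fin n → F, X ⬝ᵥ A.mulVec X = (L.mulVec X) ⬝ᵥ B.mulVec (L.mulVec X)

/-- Matrix of the standard hyperbolic quadratic form `X₁X₂ + ⋯ + X_{2r−1}X_{2r}`
in `n` variables. -/
def stdHyp (F : Type*) [Field F] (n r : ℕ) : Matrix (Fin n) (Fin n) F :=
  Matrix.of fun i j =>
    if i.val % 2 = 0 ∧ j.val = i.val + 1 ∧ j.val < 2 * r then 1 else 0

/-- Matrix of the standard form `a X₁² + b X₁X₂ + c X₂² + X₃X₄ + ⋯ + X_{2r−1}X_{2r}`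
in `n` variables. -/
def stdEll (F : Type*) [Field F] (n r : ℕ) (a b c : F) : Matrix (Fin n) (Fin n) F :=
  Matrix.of fun i j =>
    if i.val = 0 ∧ j.val = 1 then b
    else if i.val = 0 ∧ j.val = 0 then a
    else if i.val = 1 ∧ j.val = 1 then c
    else if 2 ≤ i.val ∧ i.val % 2 = 0 ∧ j.val = i.val + 1 ∧ j.val < 2 * r then 1
    else 0

/-- A matrix is hyperbolic (of even rank `2r`) if its associated quadratic form is equivalent
to `k(X₁X₂ + ⋯ + X_{2r−1}X_{2r})` for some nonzero constant `k`. -/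
def IsHyp {F : Type*} [Field F] {n : ℕ} (A : Matrix (Fin n) (Fin n) F) (r : ℕ) : Prop :=
  ∃ k : F, k ≠ 0 ∧ QuadEquiv A (k • stdHyp F n r)

/-- A matrix is elliptic (of even rank `2r`) if its associated quadratic form is equivalent to
`k(f(X₁,X₂) + X₃X₄ + ⋯ + X_{2r−1}X_{2r})` for some nonzero `k` and some irreducible binary
quadratic `f(X,Y) = aX² + bXY + cY²`; over a finite field of odd order, irreducibility of `f`
is precisely the condition that the discriminant `b² − 4ac` is a non-square. -/
def IsEll {F : Type*} [Field F] {n : ℕ} (A : Matrix (Fin n) (Fin n) F) (r : ℕ) : Prop :=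
  ∃ k a b c : F, k ≠ 0 ∧ ¬ IsSquare (b ^ 2 - 4 * a * c) ∧
    QuadEquiv A (k • stdEll F n r a b c)

section GaussSums

variable {F : Type*} [Field F] [Fintype F]

/-- The quadratic Gauss sum `∑ x, ψ (c x²)`. -/
noncomputable def quadGaussSum (ψ : AddChar F ℂ) (c : F) : ℂ := ∑ x, ψ (c * x ^ 2)

theorem quadGaussSum_zero (ψ : AddChar F ℂ) : quadGaussSum ψ 0 = Fintype.card F := by
  simp [quadGaussSum]

theorem quadGaussSum_mul_sq (ψ : AddChar F ℂ) (c : F) {u : F} (hu : u ≠ 0) :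
    quadGaussSum ψ (c * u ^ 2) = quadGaussSum ψ c := by
  refine Fintype.sum_equiv (Equiv.mulLeft₀ u hu) _ _ fun x => ?_
  simp [mul_pow, mul_assoc]

theorem sum_addChar_mul [DecidableEq F] {ψ : AddChar F ℂ} (hψ : ψ.IsPrimitive) (c : F) :
    ∑ x, ψ (c * x) = if c = 0 then (Fintype.card F : ℂ) else 0 := by
  simpa [mul_comm] using AddChar.sum_mulShift c hψ

theorem quadGaussSum_mul_neg {ψ : AddChar F ℂ} (hψ : ψ.IsPrimitive) (h2 : (2 : F) ≠ 0)
    {c : F} (hc : c ≠ 0) :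
    quadGaussSum ψ c * quadGaussSum ψ (-c) = Fintype.card F := by
  classical
  have key (y : F) : ∑ x, ψ (c * x ^ 2) * ψ (-c * y ^ 2) =
      ∑ t, ψ (c * t ^ 2) * ψ (2 * c * t * y) := by
    refine Fintype.sum_equiv (Equiv.subRight y) _ _ fun x => ?_
    rw [← AddChar.map_add_eq_mul, ← AddChar.map_add_eq_mul, Equiv.subRight_apply]
    congr 1
    ring
  rw [quadGaussSum, quadGaussSum, Finset.sum_mul_sum, Finset.sum_comm]
  simp_rw [key]
  rw [Finset.sum_comm]
  simp_rw [← Finset.mul_sum, sum_addChar_mul hψ]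
  simp [h2, hc]

theorem quadGaussSum_ne_zero {ψ : AddChar F ℂ} (hψ : ψ.IsPrimitive) (h2 : (2 : F) ≠ 0)
    {c : F} (hc : c ≠ 0) : quadGaussSum ψ c ≠ 0 := by
  intro h
  have := quadGaussSum_mul_neg hψ h2 hc
  rw [h, zero_mul] at this
  exact Nat.cast_ne_zero.2 Fintype.card_ne_zero this.symm

theorem quadGaussSum_mul_of_not_isSquare {ψ : AddChar F ℂ} (hψ : ψ.IsPrimitive)
    (hF : ringChar F ≠ 2) {n : F} (hn : ¬ IsSquare n) {c : F} (hc : c ≠ 0) :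
    quadGaussSum ψ (c * n) = -quadGaussSum ψ c := by
  classical
  have hn0 : n ≠ 0 := by rintro rfl; exact hn (.zero)
  have key (a : F) (ha : a ≠ 0) :
      quadGaussSum ψ a = ∑ y, (quadraticChar F y : ℂ) * ψ (a * y) := by
    have h0 : ∑ y, ψ (a * y) = 0 := by simp [sum_addChar_mul hψ, ha]
    rw [← add_zero (∑ y, (quadraticChar F y : ℂ) * ψ (a * y)), ← h0, ← Finset.sum_add_distrib,
      quadGaussSum, ← Finset.sum_fiberwise (g := fun x : F => x ^ 2)]
    refine Finset.sum_congr rfl fun y _ => ?_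
    have hcard := quadraticChar_card_sqrts hF y
    rw [Finset.sum_congr rfl (g := fun _ => ψ (a * y))
      (fun x hx => by rw [(Finset.mem_filter.1 hx).2]), Finset.sum_const, nsmul_eq_mul,
      ← add_one_mul]
    congr 1
    have h' : ((Finset.univ.filter fun x : F => x ^ 2 = y).card : ℤ) = quadraticChar F y + 1 := by
      rw [← hcard]
      congr 2
      ext x
      simp
    exact_mod_cast h'
  rw [key _ (mul_ne_zero hc hn0), key _ hc, ← Finset.sum_neg_distrib]
  refine Fintype.sum_equiv (Equiv.mulLeft₀ n hn0) _ _ fun y => ?_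
  have hχ : quadraticChar F n = -1 := quadraticChar_neg_one_iff_not_isSquare.2 hn
  simp only [Equiv.mulLeft₀_apply, map_mul, hχ, mul_assoc]
  push_cast
  ring

end GaussSums

section Congruence

variable {F : Type*} [Field F] {ι : Type*} [Fintype ι]

theorem dotProduct_congruence (A L : Matrix ι ι F) (X : ι → F) :
    X ⬝ᵥ (Lᵀ * A * L) *ᵥ X = (L *ᵥ X) ⬝ᵥ A *ᵥ (L *ᵥ X) := by
  rw [← mulVec_mulVec, ← mulVec_mulVec, dotProduct_mulVec, vecMul_transpose]

variable [DecidableEq ι]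

/-- The bijection of vectors given by an invertible matrix. -/
noncomputable def mulVecEquiv (L : Matrix ι ι F) (hL : IsUnit L.det) : (ι → F) ≃ (ι → F) where
  toFun := L.mulVec
  invFun := L⁻¹.mulVec
  left_inv X := by simp [Matrix.nonsing_inv_mul _ hL]
  right_inv X := by simp [Matrix.mul_nonsing_inv _ hL]

theorem exists_diagonalization {A : Matrix ι ι F} (hA : A.IsSymm) (h2 : (2 : F) ≠ 0) :
    ∃ (L : Matrix ι ι F) (d : ι → F), IsUnit L.det ∧ Lᵀ * A * L = diagonal d := by
  have : Invertible (2 : F) := invertibleOfNonzero h2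
  let b := Pi.basisFun F ι
  let B : LinearMap.BilinForm F (ι → F) := Matrix.toBilin b A
  have hBA : LinearMap.BilinForm.toMatrix b B = A := by simp [B]
  have hB : LinearMap.BilinForm.IsSymm B := (Matrix.isSymm_toBilin_iff_isSymm b).2 hA
  obtain ⟨v, hv⟩ := LinearMap.BilinForm.exists_orthogonal_basis
    (LinearMap.BilinForm.isSymm_iff.1 hB)
  let w := v.reindex (Fintype.equivOfCardEq (by simp) : Fin (Module.finrank F (ι → F)) ≃ ι)
  refine ⟨b.toMatrix w, fun i => B (w i) (w i), ?_, ?_⟩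
  · have := b.invertibleToMatrix w
    exact Matrix.isUnit_det_of_invertible _
  · conv_lhs => rw [← hBA]
    rw [LinearMap.BilinForm.toMatrix_mul_basis_toMatrix]
    ext i j
    rw [LinearMap.BilinForm.toMatrix_apply]
    rcases eq_or_ne i j with rfl | hij
    · simp
    · rw [diagonal_apply_ne _ hij]
      simpa [w] using hv (fun h => hij (by simpa using h))

end Congruence

section QuadSum

variable {F : Type*} [Field F] [Fintype F] {ι : Type*} [Fintype ι] [DecidableEq ι]

/-- The exponential sum `∑ X, ψ (Xᵀ A X)` of a quadratic form. -/
noncomputable def quadSum (ψ : AddChar F ℂ) (A : Matrix ι ι F) : ℂ :=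
  ∑ X : ι → F, ψ (X ⬝ᵥ A *ᵥ X)

theorem quadSum_congruence (ψ : AddChar F ℂ) (A L : Matrix ι ι F) (hL : IsUnit L.det) :
    quadSum ψ (Lᵀ * A * L) = quadSum ψ A := by
  refine Fintype.sum_equiv (mulVecEquiv L hL) _ _ fun X => ?_
  rw [dotProduct_congruence]
  rfl

theorem QuadEquiv.quadSum_eq {n : ℕ} {A B : Matrix (Fin n) (Fin n) F} (h : QuadEquiv A B)
    (ψ : AddChar F ℂ) : quadSum ψ A = quadSum ψ B := by
  obtain ⟨L, hL, h⟩ := h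
  refine Fintype.sum_equiv (mulVecEquiv L hL) _ _ fun X => ?_
  rw [h]
  rfl

theorem quadSum_diagonal (ψ : AddChar F ℂ) (d : ι → F) :
    quadSum ψ (diagonal d) = ∏ i, quadGaussSum ψ (d i) := by
  simp_rw [quadGaussSum, Finset.prod_univ_sum, Fintype.piFinset_univ, quadSum]
  refine Finset.sum_congr rfl fun X _ => ?_
  simp only [dotProduct, mulVec_diagonal]
  refine (map_prod ψ.toMonoidHom (fun i => Multiplicative.ofAdd (X i * (d i * X i))) _).trans ?_
  refine Finset.prod_congr rfl fun i _ => ?_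
  rw [AddChar.toMonoidHom_apply, toAdd_ofAdd]
  congr 1
  ring

end QuadSum

section PlaneRotation

variable {F : Type*} [Field F] {ι : Type*} [DecidableEq ι]

/-- Scaled rotation in the plane of the coordinates `i` and `j`. -/
def planeRotation (i j : ι) (x y : F) : (ι → F) →ₗ[F] (ι → F) where
  toFun X k := if k = i then x * X i - y * X j else if k = j then y * X i + x * X j else X k
  map_add' X Y := by
    ext k
    simp only [Pi.add_apply]
    split_ifs <;> ring
  map_smul' c X := by
    ext k
    simp only [Pi.smul_apply, smul_eq_mul, RingHom.id_apply]
    split_ifs <;> ring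

theorem planeRotation_comp {i j : ι} (hij : i ≠ j) {x y z t : F} (h₁ : x * z - y * t = 1)
    (h₂ : y * z + x * t = 0) (X : ι → F) :
    planeRotation i j x y (planeRotation i j z t X) = X := by
  ext k
  simp only [planeRotation, LinearMap.coe_mk, AddHom.coe_mk, if_true, if_neg hij.symm]
  split_ifs with hi hj
  · subst hi
    linear_combination X k * h₁ - X j * h₂
  · subst hj
    linear_combination X k * h₁ + X i * h₂
  · rfl

end PlaneRotation

section Classification

variable {F : Type*} [Field F] {ι : Type*} [Fintype ι]

theorem weightedSumSquares_equivalent_comp (w : ι → F) (σ : Equiv.Perm ι) :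
    (QuadraticMap.weightedSumSquares F (w ∘ σ)).Equivalent
      (QuadraticMap.weightedSumSquares F w) := by
  refine ⟨{ LinearEquiv.funCongrLeft F F σ.symm with map_app' := fun X => ?_ }⟩
  rw [QuadraticMap.weightedSumSquares_apply, QuadraticMap.weightedSumSquares_apply]
  refine (Fintype.sum_equiv σ _ _ fun i => ?_).symm
  simp [LinearEquiv.funCongrLeft]

theorem exists_equivalent_weights_mem [Fintype F] {n : F} (hn : ¬ IsSquare n) (w : ι → F) :
    ∃ w' : ι → F, (∀ i, w' i = 0 ∨ w' i = 1 ∨ w' i = n) ∧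
      (QuadraticMap.weightedSumSquares F w).Equivalent (QuadraticMap.weightedSumSquares F w') := by
  classical
  have hn0 : n ≠ 0 := by rintro rfl; exact hn (.zero)
  have key (a : F) : ∃ b : F, (b = 0 ∨ b = 1 ∨ b = n) ∧ ∃ u : Fˣ, b * (u : F) ^ 2 = a := by
    rcases eq_or_ne a 0 with rfl | ha
    · exact ⟨0, by simp, 1, by simp⟩
    by_cases hsq : IsSquare a
    · obtain ⟨u, rfl⟩ := hsq
      exact ⟨1, by simp, Units.mk0 u (by rintro rfl; simp at ha), by simp [sq]⟩
    · have : IsSquare (n * a) := by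
        rw [← quadraticChar_one_iff_isSquare (mul_ne_zero hn0 ha), map_mul,
          quadraticChar_neg_one_iff_not_isSquare.2 hn, quadraticChar_neg_one_iff_not_isSquare.2 hsq]
        norm_num
      obtain ⟨u, hu⟩ := this
      have hu0 : u ≠ 0 := by
        rintro rfl
        exact mul_ne_zero hn0 ha (by simpa using hu)
      refine ⟨n, by simp, Units.mk0 (n⁻¹ * u) (mul_ne_zero (inv_ne_zero hn0) hu0), ?_⟩
      simp only [Units.val_mk0]
      field_simp
      linear_combination -hu
  choose b hb u hu using key
  exact ⟨fun i => b (w i), fun i => hb _,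
    ⟨QuadraticForm.isometryEquivWeightedSumSquaresWeightedSumSquares (fun i => u (w i))
      fun i => hu _⟩⟩

variable [DecidableEq ι]

theorem toQuadraticForm'_eq_dotProduct (A : Matrix ι ι F) (X : ι → F) :
    A.toQuadraticForm' X = X ⬝ᵥ A *ᵥ X := by
  rw [Matrix.toQuadraticForm', LinearMap.BilinMap.toQuadraticMap_apply,
    Matrix.toLinearMap₂'_apply']

theorem toQuadraticForm'_diagonal (d : ι → F) :
    (diagonal d).toQuadraticForm' = QuadraticMap.weightedSumSquares F d := by
  ext X
  rw [toQuadraticForm'_eq_dotProduct, QuadraticMap.weightedSumSquares_apply]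
  simp only [dotProduct, mulVec_diagonal, smul_eq_mul]
  exact Finset.sum_congr rfl fun i _ => by ring

theorem quadEquiv_of_equivalent {n : ℕ} {A B : Matrix (Fin n) (Fin n) F}
    (h : A.toQuadraticForm'.Equivalent B.toQuadraticForm') : QuadEquiv A B := by
  obtain ⟨e⟩ := h
  refine ⟨LinearMap.toMatrix' (e.toLinearEquiv : (Fin n → F) →ₗ[F] (Fin n → F)), ?_, fun X => ?_⟩
  · rw [LinearMap.det_toMatrix']
    exact e.toLinearEquiv.isUnit_det'
  · rw [← toQuadraticForm'_eq_dotProduct, ← toQuadraticForm'_eq_dotProduct,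
      LinearMap.toMatrix'_mulVec]
    exact (e.map_app X).symm

theorem quadSum_eq_of_equivalent [Fintype F] {A B : Matrix ι ι F}
    (h : A.toQuadraticForm'.Equivalent B.toQuadraticForm') (ψ : AddChar F ℂ) :
    quadSum ψ A = quadSum ψ B := by
  obtain ⟨e⟩ := h
  refine Fintype.sum_equiv e.toLinearEquiv.toEquiv _ _ fun X => ?_
  rw [← toQuadraticForm'_eq_dotProduct, ← toQuadraticForm'_eq_dotProduct]
  exact congrArg ψ (e.map_app X).symm

theorem exists_sq_add_sq_eq [Fintype F] (hF : ringChar F ≠ 2) (n : F) :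
    ∃ x y : F, x ^ 2 + y ^ 2 = n := by
  obtain ⟨x, y, h⟩ := FiniteField.exists_root_sum_quadratic (Polynomial.degree_X_pow 2)
    (Polynomial.degree_X_pow_sub_C (n := 2) (by decide) n) (FiniteField.odd_card_of_char_ne_two hF)
  refine ⟨x, y, sub_eq_zero.1 ?_⟩
  simpa only [Polynomial.eval_sub, Polynomial.eval_pow, Polynomial.eval_X, Polynomial.eval_C,
    add_sub_assoc] using h

theorem weightedSumSquares_equivalent_update [Fintype F] (hF : ringChar F ≠ 2) {w : ι → F}
    {n : F} (hn : n ≠ 0) {i j : ι} (hij : i ≠ j) (hi : w i = n) (hj : w j = n) :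
    (QuadraticMap.weightedSumSquares F w).Equivalent
      (QuadraticMap.weightedSumSquares F (Function.update (Function.update w i 1) j 1)) := by
  obtain ⟨x, y, hxy⟩ := exists_sq_add_sq_eq hF n
  have h₁ : x * (n⁻¹ * x) - y * (-(n⁻¹ * y)) = 1 := by field_simp; linear_combination hxy
  have h₂ : y * (n⁻¹ * x) + x * (-(n⁻¹ * y)) = 0 := by ring
  refine ⟨{ planeRotation i j x y with
    invFun := planeRotation i j (n⁻¹ * x) (-(n⁻¹ * y))
    left_inv := planeRotation_comp hij (by linear_combination h₁) (by ring)
    right_inv := planeRotation_comp hij h₁ h₂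
    map_app' := fun X => ?_ }⟩
  rw [QuadraticMap.weightedSumSquares_apply, QuadraticMap.weightedSumSquares_apply]
  have hmem : j ∈ Finset.univ.erase i := by simp [hij.symm]
  rw [← Finset.add_sum_erase _ _ (Finset.mem_univ i), ← Finset.add_sum_erase _ _ hmem,
    ← Finset.add_sum_erase (a := i) _ _ (Finset.mem_univ i), ← Finset.add_sum_erase _ _ hmem,
    ← add_assoc, ← add_assoc]
  refine congrArg₂ _ ?_ (Finset.sum_congr rfl fun k hk => ?_)
  · simp [planeRotation, hij, hij.symm, hi, hj]
    linear_combination (X i ^ 2 + X j ^ 2) * hxy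
  · simp only [Finset.mem_erase, Finset.mem_univ, and_true] at hk
    simp [planeRotation, hk.1, hk.2]

theorem exists_equivalent_weights_subsingleton [Fintype F] [DecidableEq F] (hF : ringChar F ≠ 2)
    {n : F} (hn : ¬ IsSquare n) (w : ι → F) :
    ∃ w' : ι → F, (∀ i, w' i = 0 ∨ w' i = 1 ∨ w' i = n) ∧
      (Finset.univ.filter fun i => w' i = n).card ≤ 1 ∧
      (QuadraticMap.weightedSumSquares F w).Equivalent (QuadraticMap.weightedSumSquares F w') := by
  have hn0 : n ≠ 0 := by rintro rfl; exact hn (.zero)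
  have hn1 : n ≠ 1 := by rintro rfl; exact hn (.one)
  obtain ⟨v, hv, hwv⟩ := exists_equivalent_weights_mem hn w
  induction hk : (Finset.univ.filter fun i => v i = n).card using Nat.strong_induction_on
    generalizing v with
  | h k ih =>
  by_cases hk1 : k ≤ 1
  · exact ⟨v, hv, hk ▸ hk1, hwv⟩
  obtain ⟨i, hi, j, hj, hij⟩ := Finset.one_lt_card.1 (hk ▸ not_le.1 hk1)
  rw [Finset.mem_filter_univ] at hi hj
  refine ih _ ?_ (Function.update (Function.update v i 1) j 1) (fun k => ?_)
    (hwv.trans (weightedSumSquares_equivalent_update hF hn0 hij hi hj)) rfl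
  · rw [← hk]
    refine Finset.card_lt_card ⟨fun k hk' => ?_, fun hsub => ?_⟩
    · rw [Finset.mem_filter_univ] at hk' ⊢
      by_cases hkj : k = j
      · exact hkj ▸ hj
      by_cases hki : k = i
      · exact hki ▸ hi
      simpa [Function.update, hkj, hki] using hk'
    · have := hsub (Finset.mem_filter_univ j |>.2 hj)
      rw [Finset.mem_filter_univ, Function.update_self] at this
      exact hn1 this.symm
  · simp only [Function.update_apply]
    split_ifs
    · simp
    · simp
    · exact hv k

theorem sq_quadGaussSum_one [Fintype F] {ψ : AddChar F ℂ} (hψ : ψ.IsPrimitive)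
    (hF : ringChar F ≠ 2) :
    quadGaussSum ψ (1 : F) ^ 2 = Fintype.card F ∨ quadGaussSum ψ (1 : F) ^ 2 = -Fintype.card F := by
  have h2 : (2 : F) ≠ 0 := Ring.two_ne_zero hF
  have h := quadGaussSum_mul_neg hψ h2 one_ne_zero
  by_cases hsq : IsSquare (-1 : F)
  · obtain ⟨u, hu⟩ := hsq
    rw [show -1 = (1 : F) * u ^ 2 by rw [hu]; ring, quadGaussSum_mul_sq] at h
    · left; rw [← h, sq]
    · rintro rfl
      simp at hu
  · right
    have := quadGaussSum_mul_of_not_isSquare hψ hF hsq one_ne_zero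
    rw [one_mul] at this
    rw [← h, this]
    ring

theorem norm_quadGaussSum_one [Fintype F] {ψ : AddChar F ℂ} (hψ : ψ.IsPrimitive)
    (hF : ringChar F ≠ 2) : ‖quadGaussSum ψ (1 : F)‖ ^ 2 = Fintype.card F := by
  rw [← norm_pow]
  rcases sq_quadGaussSum_one hψ hF with h | h <;> simp [h]

theorem quadSum_diagonal_of_mem [Fintype F] [DecidableEq F] {ψ : AddChar F ℂ}
    (hψ : ψ.IsPrimitive) (hF : ringChar F ≠ 2) {n : F} (hn : ¬ IsSquare n) {w : ι → F}
    (hw : ∀ i, w i = 0 ∨ w i = 1 ∨ w i = n) :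
    quadSum ψ (diagonal w) =
      (Fintype.card F : ℂ) ^ (Finset.univ.filter fun i => w i = 0).card *
      quadGaussSum ψ (1 : F) ^ (Finset.univ.filter fun i => ¬ w i = 0).card *
      (-1) ^ (Finset.univ.filter fun i => w i = n).card := by
  have hn0 : n ≠ 0 := by rintro rfl; exact hn (.zero)
  have hn1 : n ≠ 1 := by rintro rfl; exact hn (.one)
  have key (i : ι) : quadGaussSum ψ (w i) =
      (if w i = 0 then (Fintype.card F : ℂ) else quadGaussSum ψ (1 : F)) *
        (if w i = n then -1 else 1) := by
    rcases hw i with h | h | h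
    · simp [h, quadGaussSum_zero, hn0.symm]
    · simp [h, hn1.symm]
    · have := quadGaussSum_mul_of_not_isSquare hψ hF hn one_ne_zero
      rw [one_mul] at this
      simp [h, hn0, this]
  rw [quadSum_diagonal]
  simp_rw [key]
  rw [Finset.prod_mul_distrib, Finset.prod_ite, Finset.prod_ite]
  simp

theorem weightedSumSquares_equivalent_of_quadSum_eq [Fintype F] {ψ : AddChar F ℂ}
    (hψ : ψ.IsPrimitive) (hF : ringChar F ≠ 2) {w w' : ι → F}
    (h : quadSum ψ (diagonal w) = quadSum ψ (diagonal w')) :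
    (QuadraticMap.weightedSumSquares F w).Equivalent (QuadraticMap.weightedSumSquares F w') := by
  classical
  obtain ⟨n, hn⟩ := FiniteField.exists_nonsquare hF
  have hn0 : n ≠ 0 := by rintro rfl; exact hn (.zero)
  have hn1 : n ≠ 1 := by rintro rfl; exact hn (.one)
  obtain ⟨v, hv, hv1, hwv⟩ := exists_equivalent_weights_subsingleton hF hn w
  obtain ⟨v', hv', hv1', hwv'⟩ := exists_equivalent_weights_subsingleton hF hn w'
  refine hwv.trans (QuadraticMap.Equivalent.trans ?_ hwv'.symm)
  have hq (u u' : ι → F) (h : (QuadraticMap.weightedSumSquares F u).Equivalent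
      (QuadraticMap.weightedSumSquares F u')) :
      quadSum ψ (diagonal u) = quadSum ψ (diagonal u') :=
    quadSum_eq_of_equivalent (by simpa only [toQuadraticForm'_diagonal] using h) ψ
  rw [hq _ _ hwv, hq _ _ hwv', quadSum_diagonal_of_mem hψ hF hn hv,
    quadSum_diagonal_of_mem hψ hF hn hv'] at h
  have hcard (u : ι → F) : (Finset.univ.filter fun i => u i = 0).card +
      (Finset.univ.filter fun i => ¬ u i = 0).card = Fintype.card ι :=
    Finset.card_filter_add_card_filter_not _
  have hcard' (u : ι → F) (hu : ∀ i, u i = 0 ∨ u i = 1 ∨ u i = n) :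
      (Finset.univ.filter fun i => ¬ u i = 0).card =
        (Finset.univ.filter fun i => u i = 1).card +
        (Finset.univ.filter fun i => u i = n).card := by
    rw [← Finset.card_union_of_disjoint]
    · congr 1
      ext i
      rcases hu i with h | h | h <;> simp [h, hn0, hn0.symm]
    · rw [Finset.disjoint_filter]
      rintro i - h1 hn'
      exact hn1 (hn'.symm.trans h1)
  have hG := norm_quadGaussSum_one hψ hF
  have h0 : (Finset.univ.filter fun i => v i = 0).card =
      (Finset.univ.filter fun i => v' i = 0).card := by
    have hn := congrArg (fun z : ℂ => ‖z‖ ^ 2) h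
    simp only [norm_mul, norm_pow, norm_neg, norm_one, one_pow, mul_one, Complex.norm_natCast,
      mul_pow, ← pow_mul, mul_comm _ 2] at hn
    simp only [pow_mul, hG] at hn
    simp only [← pow_mul, ← pow_add] at hn
    have := Nat.pow_right_injective (Fintype.one_lt_card (α := F)) (by exact_mod_cast hn)
    have := hcard v
    have := hcard v'
    omega
  have h0' : (Finset.univ.filter fun i => ¬ v i = 0).card =
      (Finset.univ.filter fun i => ¬ v' i = 0).card := by
    have := hcard v
    have := hcard v'
    omega
  have hnn : (Finset.univ.filter fun i => v i = n).card =
      (Finset.univ.filter fun i => v' i = n).card := by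
    rw [h0, h0'] at h
    have h' := mul_left_cancel₀ (mul_ne_zero (pow_ne_zero _ (Nat.cast_ne_zero.2
      Fintype.card_ne_zero)) (pow_ne_zero _ (quadGaussSum_ne_zero hψ (Ring.two_ne_zero hF)
        one_ne_zero))) h
    interval_cases (Finset.univ.filter fun i => v i = n).card <;>
    interval_cases (Finset.univ.filter fun i => v' i = n).card <;>
    first | rfl | (norm_num at h')
  have h1 : (Finset.univ.filter fun i => v i = 1).card =
      (Finset.univ.filter fun i => v' i = 1).card := by
    have := hcard' v hv
    have := hcard' v' hv'
    omega
  have hfib (c : F) : Nonempty ({i // v i = c} ≃ {i // v' i = c}) := by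
    rw [← Fintype.card_eq, Fintype.card_subtype, Fintype.card_subtype]
    by_cases hc0 : c = 0
    · rwa [hc0]
    by_cases hc1 : c = 1
    · rwa [hc1]
    by_cases hcn : c = n
    · rwa [hcn]
    rw [Finset.filter_false_of_mem, Finset.filter_false_of_mem]
    · rintro i - rfl
      exact (hv' i).elim hc0 fun h => h.elim hc1 hcn
    · rintro i - rfl
      exact (hv i).elim hc0 fun h => h.elim hc1 hcn
  let σ : Equiv.Perm ι := Equiv.ofFiberEquiv fun c => (hfib c).some
  have hσ : v' ∘ σ = v := funext fun i => Equiv.ofFiberEquiv_map _ i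
  rw [← hσ]
  exact weightedSumSquares_equivalent_comp v' σ

end Classification

theorem equivalent_of_quadSum_eq {F : Type*} [Field F] [Fintype F] {n : ℕ} {ψ : AddChar F ℂ}
    (hψ : ψ.IsPrimitive) (hF : ringChar F ≠ 2) {A B : Matrix (Fin n) (Fin n) F}
    (h : quadSum ψ A = quadSum ψ B) :
    A.toQuadraticForm'.Equivalent B.toQuadraticForm' := by
  have : Invertible (2 : F) := invertibleOfNonzero (Ring.two_ne_zero hF)
  have key (C : Matrix (Fin n) (Fin n) F) : ∃ w : Fin n → F,
      C.toQuadraticForm'.Equivalent (QuadraticMap.weightedSumSquares F w) := by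
    have := QuadraticForm.equivalent_weightedSumSquares C.toQuadraticForm'
    rwa [Module.finrank_fin_fun] at this
  obtain ⟨w, hw⟩ := key A
  obtain ⟨w', hw'⟩ := key B
  refine hw.trans (QuadraticMap.Equivalent.trans ?_ hw'.symm)
  refine weightedSumSquares_equivalent_of_quadSum_eq hψ hF ?_
  rw [← quadSum_eq_of_equivalent (toQuadraticForm'_diagonal w ▸ hw), h,
    quadSum_eq_of_equivalent (toQuadraticForm'_diagonal w' ▸ hw')]

section StandardForms

variable {F : Type*} [Field F] [Fintype F]

theorem quadSum_eq_binary_mul {m : ℕ} (ψ : AddChar F ℂ) {M : Matrix (Fin (m + 2)) (Fin (m + 2)) F}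
    {N : Matrix (Fin m) (Fin m) F} {a b c : F} (h00 : M 0 0 = a) (h01 : M 0 1 = b)
    (h10 : M 1 0 = 0) (h11 : M 1 1 = c) (h0 : ∀ j : Fin m, M 0 j.succ.succ = 0)
    (h1 : ∀ j : Fin m, M 1 j.succ.succ = 0) (h0' : ∀ j : Fin m, M j.succ.succ 0 = 0)
    (h1' : ∀ j : Fin m, M j.succ.succ 1 = 0)
    (hN : ∀ i j : Fin m, M i.succ.succ j.succ.succ = N i j) :
    quadSum ψ M = (∑ x, ∑ y, ψ (a * x ^ 2 + b * x * y + c * y ^ 2)) * quadSum ψ N := by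
  have key (x y : F) (Z : Fin m → F) :
      (vecCons x (vecCons y Z)) ⬝ᵥ M *ᵥ (vecCons x (vecCons y Z)) =
        (a * x ^ 2 + b * x * y + c * y ^ 2) + Z ⬝ᵥ N *ᵥ Z := by
    simp only [dotProduct, mulVec, Fin.sum_univ_succ, cons_val_zero, cons_val_succ,
      Fin.succ_zero_eq_one, h00, h01, h10, h11, h0, h1, h0', h1', hN]
    simp only [zero_mul, Finset.sum_const_zero, zero_add, add_zero]
    ring
  rw [quadSum, ← (Fin.consEquiv fun _ => F).sum_comp, Fintype.sum_prod_type, Finset.sum_mul]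
  refine Finset.sum_congr rfl fun x _ => ?_
  rw [← (Fin.consEquiv fun _ => F).sum_comp, Fintype.sum_prod_type, Finset.sum_mul]
  refine Finset.sum_congr rfl fun y _ => ?_
  rw [quadSum, Finset.mul_sum]
  refine Finset.sum_congr rfl fun Z _ => ?_
  rw [← AddChar.map_add_eq_mul, ← key]
  rfl

theorem sum_addChar_mul_mul {ψ : AddChar F ℂ} (hψ : ψ.IsPrimitive) {k : F} (hk : k ≠ 0) :
    ∑ x, ∑ y, ψ (0 * x ^ 2 + k * x * y + 0 * y ^ 2) = Fintype.card F := by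
  classical
  simp [sum_addChar_mul hψ, hk]

theorem sum_addChar_binary {ψ : AddChar F ℂ} (hψ : ψ.IsPrimitive) (hF : ringChar F ≠ 2)
    {k a b c : F} (hk : k ≠ 0) (hD : ¬ IsSquare (b ^ 2 - 4 * a * c)) :
    ∑ x, ∑ y, ψ (k * a * x ^ 2 + k * b * x * y + k * c * y ^ 2) = -Fintype.card F := by
  have h2 : (2 : F) ≠ 0 := Ring.two_ne_zero hF
  have h4 : (4 : F) ≠ 0 := by
    rw [show (4 : F) = 2 * 2 by norm_num]
    exact mul_ne_zero h2 h2
  have ha : a ≠ 0 := by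
    rintro rfl
    exact hD ⟨b, by ring⟩
  have hl : k * (4 * a)⁻¹ ≠ 0 :=
    mul_ne_zero hk (inv_ne_zero (mul_ne_zero h4 ha))
  have key (y : F) : ∑ x, ψ (k * a * x ^ 2 + k * b * x * y + k * c * y ^ 2) =
      quadGaussSum ψ (k * (4 * a)⁻¹) *
        ψ (-(k * (4 * a)⁻¹) * (b ^ 2 - 4 * a * c) * y ^ 2) := by
    rw [quadGaussSum, Finset.sum_mul]
    refine Fintype.sum_equiv ((Equiv.mulLeft₀ (2 * a) (mul_ne_zero h2 ha)).trans
      (Equiv.addRight (b * y))) _ _ fun x => ?_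
    rw [← AddChar.map_add_eq_mul]
    congr 1
    simp only [Equiv.trans_apply, Equiv.mulLeft₀_apply, Equiv.coe_addRight]
    field_simp
    ring
  rw [Finset.sum_comm]
  simp_rw [key]
  rw [← Finset.mul_sum, ← quadGaussSum,
    quadGaussSum_mul_of_not_isSquare hψ hF hD (neg_ne_zero.2 hl), mul_neg,
    quadGaussSum_mul_neg hψ h2 hl]

theorem quadSum_smul_stdHyp {ψ : AddChar F ℂ} (hψ : ψ.IsPrimitive) {k : F} (hk : k ≠ 0)
    {m r : ℕ} (h : 2 * r ≤ m) :
    quadSum ψ (k • stdHyp F m r) = (Fintype.card F : ℂ) ^ (m - r) := by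
  induction r generalizing m with
  | zero => simp [quadSum, show stdHyp F m 0 = 0 by ext; simp [stdHyp]]
  | succ r ih =>
    obtain ⟨m, rfl⟩ : ∃ n, m = n + 2 := ⟨m - 2, by omega⟩
    rw [quadSum_eq_binary_mul ψ (N := k • stdHyp F m r) (a := 0) (b := k) (c := 0),
      sum_addChar_mul_mul hψ hk, ih (by omega), ← pow_succ']
    · congr 1
      omega
    all_goals intros
    all_goals simp [stdHyp]
    all_goals grind

theorem quadSum_smul_stdEll {ψ : AddChar F ℂ} (hψ : ψ.IsPrimitive) (hF : ringChar F ≠ 2)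
    {k a b c : F} (hk : k ≠ 0) (hD : ¬ IsSquare (b ^ 2 - 4 * a * c)) {m r : ℕ} (hr : 1 ≤ r)
    (h : 2 * r ≤ m) :
    quadSum ψ (k • stdEll F m r a b c) = -(Fintype.card F : ℂ) ^ (m - r) := by
  obtain ⟨m, rfl⟩ : ∃ n, m = n + 2 := ⟨m - 2, by omega⟩
  obtain ⟨r, rfl⟩ : ∃ n, r = n + 1 := ⟨r - 1, by omega⟩
  rw [quadSum_eq_binary_mul ψ (N := k • stdHyp F m r) (a := k * a) (b := k * b) (c := k * c),
    sum_addChar_binary hψ hF hk hD, quadSum_smul_stdHyp hψ hk (by omega), neg_mul, ← pow_succ']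
  · congr 2
    omega
  all_goals intros
  all_goals simp [stdEll, stdHyp]
  grind

end StandardForms

section Rank

variable {F : Type*} [Field F] {ι : Type*} [Fintype ι] [DecidableEq ι]

theorem rank_congruence (A : Matrix ι ι F) {L : Matrix ι ι F} (hL : IsUnit L.det) :
    (Lᵀ * A * L).rank = A.rank := by
  rw [rank_mul_eq_left_of_isUnit_det _ _ hL,
    rank_mul_eq_right_of_isUnit_det _ _ (by rwa [det_transpose])]

theorem exists_isUnit_det_mulVec_eq {X Y : ι → F} (hX : X ≠ 0) (hY : Y ≠ 0) :
    ∃ P : Matrix ι ι F, IsUnit P.det ∧ P *ᵥ X = Y := by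
  obtain ⟨g, hg⟩ := Submodule.exists_linearEquiv_restrict_eq
    ((LinearEquiv.toSpanNonzeroSingleton F _ X hX).symm ≪≫ₗ
      LinearEquiv.toSpanNonzeroSingleton F _ Y hY)
  refine ⟨LinearMap.toMatrix' (g : (ι → F) →ₗ[F] ι → F), ?_, ?_⟩
  · rw [LinearMap.det_toMatrix']
    exact g.isUnit_det'
  · rw [LinearMap.toMatrix'_mulVec]
    have := hg (LinearEquiv.toSpanNonzeroSingleton F _ X hX 1)
    rw [LinearEquiv.trans_apply, LinearEquiv.symm_apply_apply] at this
    simpa using this.symm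

variable [Fintype F]

theorem card_mulVec_eq_zero_mul [DecidableEq F] (A : Matrix ι ι F) :
    (Finset.univ.filter fun X => A *ᵥ X = 0).card * Fintype.card F ^ A.rank =
      Fintype.card F ^ Fintype.card ι := by
  have h := A.mulVecLin.finrank_range_add_finrank_ker
  rw [Module.finrank_pi] at h
  rw [← h, add_comm, pow_add]
  congr 1
  rw [← Fintype.card_subtype, ← Nat.card_eq_fintype_card, ← Nat.card_eq_fintype_card (α := F),
    ← Module.natCard_eq_pow_finrank]
  rfl

theorem sum_comp_mulVec [DecidableEq F] (A : Matrix ι ι F) {f : (ι → F) → ℂ}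
    (hf : ∀ v, v ∉ Set.range A.mulVec → f v = 0) :
    (Fintype.card F : ℂ) ^ A.rank * ∑ w, f (A *ᵥ w) =
      (Fintype.card F : ℂ) ^ Fintype.card ι * ∑ v, f v := by
  have key : ∑ w, f (A *ᵥ w) =
      (Finset.univ.filter fun X => A *ᵥ X = 0).card * ∑ v, f v := by
    rw [← Finset.sum_fiberwise (g := fun w => A *ᵥ w), Finset.mul_sum]
    refine Finset.sum_congr rfl fun v _ => ?_
    rw [Finset.sum_congr rfl (g := fun _ => f v)
      (fun w hw => by rw [(Finset.mem_filter.1 hw).2]), Finset.sum_const, nsmul_eq_mul]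
    by_cases hv : v ∈ Set.range A.mulVec
    · have hcard : (Finset.univ.filter fun X => A *ᵥ X = v).card =
          (Finset.univ.filter fun X => A *ᵥ X = 0).card :=
        AddMonoidHom.card_fiber_eq_of_mem_range A.mulVecLin hv ⟨0, map_zero _⟩
      rw [hcard]
    · rw [hf v hv, mul_zero, mul_zero]
  rw [key, ← mul_assoc, mul_comm (_ ^ _), ← Nat.cast_pow, ← Nat.cast_mul,
    card_mulVec_eq_zero_mul, Nat.cast_pow]

theorem quadSum_smul_of_not_isSquare {ψ : AddChar F ℂ} (hψ : ψ.IsPrimitive)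
    (hF : ringChar F ≠ 2) {n : F} (hn : ¬ IsSquare n) {A : Matrix ι ι F} (hA : A.IsSymm) :
    quadSum ψ (n • A) = (-1) ^ A.rank * quadSum ψ A := by
  classical
  obtain ⟨L, d, hL, hd⟩ := exists_diagonalization hA (Ring.two_ne_zero hF)
  have key (i : ι) : quadGaussSum ψ (n * d i) =
      (if d i ≠ 0 then -1 else 1) * quadGaussSum ψ (d i) := by
    split_ifs with h
    · rw [mul_comm, quadGaussSum_mul_of_not_isSquare hψ hF hn h, neg_one_mul]
    · simp [not_not.1 h]
  have hd' : Lᵀ * (n • A) * L = diagonal fun i => n * d i := by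
    rw [Matrix.mul_smul, Matrix.smul_mul, hd, ← diagonal_smul]
    rfl
  rw [← quadSum_congruence ψ A L hL, ← quadSum_congruence ψ (n • A) L hL,
    ← rank_congruence A hL, hd', hd, quadSum_diagonal, quadSum_diagonal, rank_diagonal]
  simp_rw [key]
  rw [Finset.prod_mul_distrib, Finset.prod_ite, Finset.prod_const, Finset.prod_const_one, mul_one,
    Fintype.card_subtype]

theorem sq_quadGaussSum {ψ : AddChar F ℂ} (hψ : ψ.IsPrimitive) (hF : ringChar F ≠ 2) {c : F}
    (hc : c ≠ 0) : quadGaussSum ψ c ^ 2 = quadGaussSum ψ 1 ^ 2 := by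
  by_cases hsq : IsSquare c
  · obtain ⟨u, rfl⟩ := hsq
    rw [← sq, ← one_mul (u ^ 2), quadGaussSum_mul_sq]
    exact left_ne_zero_of_mul hc
  · rw [← one_mul c, quadGaussSum_mul_of_not_isSquare hψ hF hsq one_ne_zero, neg_sq]

theorem quadSum_eq_or_eq_neg {ψ : AddChar F ℂ} (hψ : ψ.IsPrimitive) (hF : ringChar F ≠ 2)
    {A : Matrix ι ι F} (hA : A.IsSymm) {r : ℕ} (hr : A.rank = 2 * r) :
    quadSum ψ A = (Fintype.card F : ℂ) ^ (Fintype.card ι - r) ∨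
      quadSum ψ A = -(Fintype.card F : ℂ) ^ (Fintype.card ι - r) := by
  classical
  obtain ⟨L, d, hL, hd⟩ := exists_diagonalization hA (Ring.two_ne_zero hF)
  have hle : 2 * r ≤ Fintype.card ι := hr ▸ rank_le_card_width A
  rw [← rank_congruence A hL, hd, rank_diagonal, Fintype.card_subtype] at hr
  have hr' : (Finset.univ.filter fun i => ¬ d i ≠ 0).card = Fintype.card ι - 2 * r := by
    have := Finset.card_filter_add_card_filter_not (s := (Finset.univ : Finset ι)) (d · ≠ 0)
    rw [Finset.card_univ] at this
    omega
  have key (i : ι) : quadGaussSum ψ (d i) ^ 2 =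
      if d i ≠ 0 then quadGaussSum ψ 1 ^ 2 else (Fintype.card F : ℂ) ^ 2 := by
    split_ifs with h
    · exact sq_quadGaussSum hψ hF h
    · rw [not_not.1 h, quadGaussSum_zero]
  rw [← sq_eq_sq_iff_eq_or_eq_neg, ← quadSum_congruence ψ A L hL, hd, quadSum_diagonal,
    ← Finset.prod_pow]
  simp_rw [key]
  have h4 : (quadGaussSum ψ (1 : F) ^ 2) ^ 2 = (Fintype.card F : ℂ) ^ 2 := by
    rcases sq_quadGaussSum_one hψ hF with h | h <;> simp [h]
  rw [Finset.prod_ite, Finset.prod_const, Finset.prod_const, hr, hr', pow_mul, h4, ← pow_mul,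
    ← pow_mul, ← pow_add, ← pow_mul]
  congr 1
  omega

end Rank

section Bordered

variable {F : Type*} [Field F] {ι : Type*}

/-- The symmetric matrix with corner entry `a`, border `v` and remaining block `B`. -/
def bordered (a : F) (v : ι → F) (B : Matrix ι ι F) : Matrix (Unit ⊕ ι) (Unit ⊕ ι) F :=
  fromBlocks (of fun _ _ => a) (replicateRow Unit v) (replicateCol Unit v) B

variable [Fintype ι] [DecidableEq ι]

theorem rank_bordered_shear (a : F) (v w : ι → F) {B : Matrix ι ι F} (hB : B.IsSymm) :
    (bordered (a + 2 * (v ⬝ᵥ w) + w ⬝ᵥ B *ᵥ w) (v + B *ᵥ w) B).rank = (bordered a v B).rank := by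
  have hdet : IsUnit (fromBlocks (1 : Matrix Unit Unit F) 0 (replicateCol Unit w) 1).det := by
    simp
  rw [← rank_congruence (bordered a v B) hdet]
  congr 1
  have hw : replicateRow Unit w * B = replicateRow Unit (B *ᵥ w) := by
    rw [← replicateRow_vecMul, ← mulVec_transpose, hB.eq]
  rw [bordered, bordered, fromBlocks_transpose, fromBlocks_multiply, fromBlocks_multiply]
  congr 1
  · ext i j
    simp only [transpose_one, Matrix.one_mul, Matrix.mul_one, transpose_replicateCol,
      Matrix.add_apply, of_apply, Matrix.add_mul]
    rw [hw]
    simp [Matrix.mul_apply, dotProduct]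
    simp_rw [mul_comm (w _)]
    ring
  · ext i j
    simp [hw]
  · ext i j
    simp [← replicateCol_mulVec]
  · simp

theorem rank_bordered_eq_of_notMem_range (h2 : (2 : F) ≠ 0) {v : ι → F} {B : Matrix ι ι F}
    (hB : B.IsSymm) (hv : v ∉ Set.range B.mulVec) (a : F) :
    (bordered a v B).rank = (bordered 0 v B).rank := by
  obtain ⟨f, hfv, hfB⟩ := Submodule.exists_le_ker_of_notMem (p := B.mulVecLin.range) (v := v) hv
  obtain ⟨u, rfl⟩ := (dotProductEquiv F ι).surjective f
  have hu : B *ᵥ u = 0 := by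
    rw [← hB.eq, mulVec_transpose]
    refine dotProduct_eq_zero _ fun w => ?_
    rw [← dotProduct_mulVec]
    exact hfB ⟨w, rfl⟩
  have hvu : u ⬝ᵥ v ≠ 0 := hfv
  have h := rank_bordered_shear 0 v ((a / (2 * (u ⬝ᵥ v))) • u) hB
  rw [mulVec_smul, hu, smul_zero, add_zero, dotProduct_zero, dotProduct_smul, dotProduct_comm v,
    smul_eq_mul] at h
  rw [← h]
  congr 2
  field_simp
  simp

variable [DecidableEq F]

theorem rank_bordered_zero (h2 : (2 : F) ≠ 0) (a : F) {B : Matrix ι ι F} (hB : B.IsSymm) :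
    (bordered a 0 B).rank = B.rank + if a = 0 then 0 else 1 := by
  obtain ⟨L, d, hL, hd⟩ := exists_diagonalization hB h2
  have hdet : IsUnit (fromBlocks (1 : Matrix Unit Unit F) 0 0 L).det := by
    simpa [det_fromBlocks_zero₁₂] using hL
  have hdiag : (fromBlocks (1 : Matrix Unit Unit F) 0 0 L)ᵀ * bordered a 0 B *
      fromBlocks (1 : Matrix Unit Unit F) 0 0 L = diagonal (Sum.elim (fun _ => a) d) := by
    rw [bordered, fromBlocks_transpose, fromBlocks_multiply, fromBlocks_multiply,
      ← fromBlocks_diagonal, ← hd]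
    congr 1
    · ext
      simp
    all_goals simp
  rw [← rank_congruence B hL, ← rank_congruence (bordered a 0 B) hdet, hdiag, hd, rank_diagonal,
    rank_diagonal, Fintype.card_subtype, Fintype.card_subtype, Finset.card_filter,
    Finset.card_filter, Fintype.sum_sum_type, add_comm]
  refine congrArg₂ _ (Finset.sum_congr rfl fun i _ => ?_) ?_
  · congr
  · rw [Finset.univ_unique, Finset.sum_singleton, Sum.elim_inl]
    split_ifs <;> simp_all

theorem rank_bordered_mulVec (h2 : (2 : F) ≠ 0) (a : F) (w : ι → F) {B : Matrix ι ι F}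
    (hB : B.IsSymm) :
    (bordered a (B *ᵥ w) B).rank = B.rank + if a = w ⬝ᵥ B *ᵥ w then 0 else 1 := by
  have h := rank_bordered_shear (a - w ⬝ᵥ B *ᵥ w) 0 w hB
  rw [rank_bordered_zero h2 _ hB] at h
  simpa [sub_eq_zero] using h

variable [Fintype F]

theorem sum_rank_bordered_eq_zero {ψ : AddChar F ℂ} (hψ : ψ.IsPrimitive) (h2 : (2 : F) ≠ 0)
    {v : ι → F} {B : Matrix ι ι F} (hB : B.IsSymm) (hv : v ∉ Set.range B.mulVec) (k : ℕ) :
    ∑ a, (if (bordered a v B).rank = k then ψ a else 0) = 0 := by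
  simp_rw [rank_bordered_eq_of_notMem_range h2 hB hv]
  split_ifs
  · simpa using sum_addChar_mul hψ 1
  · simp

theorem sum_rank_bordered_mulVec {ψ : AddChar F ℂ} (hψ : ψ.IsPrimitive) (h2 : (2 : F) ≠ 0)
    (w : ι → F) {B : Matrix ι ι F} (hB : B.IsSymm) (k : ℕ) :
    ∑ a, (if (bordered a (B *ᵥ w) B).rank = k then ψ a else 0) =
      ((if B.rank = k then 1 else 0) - (if B.rank + 1 = k then 1 else 0)) * ψ (w ⬝ᵥ B *ᵥ w) := by
  have h0 : ∑ a, ψ a = 0 := by simpa using sum_addChar_mul hψ 1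
  have key (a : F) : (if (bordered a (B *ᵥ w) B).rank = k then ψ a else 0) =
      (if B.rank + 1 = k then 1 else 0) * ψ a +
      (if a = w ⬝ᵥ B *ᵥ w then
        ((if B.rank = k then 1 else 0) - (if B.rank + 1 = k then 1 else 0)) * ψ a else 0) := by
    rw [rank_bordered_mulVec h2 a w hB]
    split_ifs <;> simp_all
  simp_rw [key]
  rw [Finset.sum_add_distrib, ← Finset.mul_sum, h0, mul_zero, zero_add, Finset.sum_ite_eq']
  simp

theorem sum_sum_rank_bordered {ψ : AddChar F ℂ} (hψ : ψ.IsPrimitive) (h2 : (2 : F) ≠ 0)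
    {B : Matrix ι ι F} (hB : B.IsSymm) (k : ℕ) :
    (Fintype.card F : ℂ) ^ Fintype.card ι *
        ∑ v, ∑ a, (if (bordered a v B).rank = k then ψ a else 0) =
      (Fintype.card F : ℂ) ^ B.rank *
        (((if B.rank = k then 1 else 0) - (if B.rank + 1 = k then 1 else 0)) * quadSum ψ B) := by
  rw [← sum_comp_mulVec B fun v hv => sum_rank_bordered_eq_zero hψ h2 hB hv k]
  simp_rw [sum_rank_bordered_mulVec hψ h2 _ hB]
  simp_rw [quadSum, Finset.mul_sum]

end Bordered

section SymmMatrix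

theorem isSymm_congruence {F : Type*} [Field F] {ι : Type*} [Fintype ι] {A : Matrix ι ι F}
    (hA : A.IsSymm) (P : Matrix ι ι F) :
    (Pᵀ * A * P).IsSymm := by
  rw [IsSymm, transpose_mul, transpose_mul, transpose_transpose, hA.eq, Matrix.mul_assoc]

theorem isSymm_bordered {F : Type*} [Field F] {ι : Type*} (a : F) (v : ι → F) {B : Matrix ι ι F}
    (hB : B.IsSymm) : (bordered a v B).IsSymm :=
  IsSymm.fromBlocks (by ext; rfl) (by ext; rfl) hB

/-- Symmetric square matrices. -/
abbrev SymmMatrix (ι F : Type*) : Type _ := {A : Matrix ι ι F // A.IsSymm}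

noncomputable instance {ι F : Type*} [Finite ι] [Finite F] : Fintype (SymmMatrix ι F) :=
  Fintype.ofFinite _

variable {F : Type*} [Field F] {ι κ : Type*}

/-- Simultaneous reindexing of rows and columns. -/
def SymmMatrix.reindex (e : ι ≃ κ) : SymmMatrix κ F ≃ SymmMatrix ι F where
  toFun A := ⟨A.1.submatrix e e, A.2.submatrix e⟩
  invFun A := ⟨A.1.submatrix e.symm e.symm, A.2.submatrix e.symm⟩
  left_inv A := Subtype.ext (by simp)
  right_inv A := Subtype.ext (by simp)

/-- Multiplication by a nonzero scalar. -/
def SymmMatrix.smulEquiv (c : F) (hc : c ≠ 0) : SymmMatrix ι F ≃ SymmMatrix ι F where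
  toFun A := ⟨c • A.1, A.2.smul c⟩
  invFun A := ⟨c⁻¹ • A.1, A.2.smul c⁻¹⟩
  left_inv A := Subtype.ext (by simp [smul_smul, hc])
  right_inv A := Subtype.ext (by simp [smul_smul, hc])

/-- A symmetric matrix is determined by its corner entry, its border and the remaining block. -/
def SymmMatrix.borderedEquiv : SymmMatrix ι F × (ι → F) × F ≃ SymmMatrix (Unit ⊕ ι) F where
  toFun x := ⟨bordered x.2.2 x.2.1 x.1.1, isSymm_bordered _ _ x.1.2⟩
  invFun A := ⟨⟨A.1.toBlocks₂₂, by ext i j; exact A.2.apply _ _⟩,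
    fun j => A.1 (Sum.inl ()) (Sum.inr j), A.1 (Sum.inl ()) (Sum.inl ())⟩
  left_inv x := rfl
  right_inv A := Subtype.ext (by
    ext (i | i) (j | j)
    · rfl
    · rfl
    · exact A.2.apply _ _
    · rfl)

theorem SymmMatrix.coe_borderedEquiv (B : SymmMatrix ι F) (v : ι → F) (a : F) :
    (borderedEquiv (B, v, a)).1 = bordered a v B.1 := rfl

/-- The number of symmetric matrices of rank `k`. -/
noncomputable def rankCount (F : Type*) [Field F] [Fintype F] (ι : Type*) [Fintype ι] (k : ℕ) : ℂ :=
  ∑ A : SymmMatrix ι F, if A.1.rank = k then 1 else 0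

variable [Fintype ι] [Fintype κ]

theorem rankCount_congr [Fintype F] (e : ι ≃ κ) (k : ℕ) : rankCount F ι k = rankCount F κ k := by
  refine (Fintype.sum_equiv (SymmMatrix.reindex e) _ _ fun A => ?_).symm
  change _ = if (A.1.submatrix e e).rank = k then 1 else 0
  rw [rank_submatrix]

section

variable [Fintype F] [DecidableEq F]

/-- The excess over symmetric `A` of rank `k` of the sum of `ψ (Xᵀ A X)` over the number of
matrices with `A X = 0`. -/
noncomputable def rankExcess (ψ : AddChar F ℂ) (k : ℕ) (X : ι → F) : ℂ :=
  ∑ A : SymmMatrix ι F,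
    if A.1.rank = k then ψ (X ⬝ᵥ A.1 *ᵥ X) - if A.1 *ᵥ X = 0 then 1 else 0 else 0

theorem rankExcess_zero (ψ : AddChar F ℂ) (k : ℕ) : rankExcess ψ k (0 : ι → F) = 0 := by
  simp [rankExcess]

end

variable [DecidableEq ι] [DecidableEq κ]

/-- The congruence action of an invertible matrix. -/
noncomputable def SymmMatrix.congruence (P : Matrix ι ι F) (hP : IsUnit P.det) :
    SymmMatrix ι F ≃ SymmMatrix ι F where
  toFun A := ⟨Pᵀ * A.1 * P, isSymm_congruence A.2 _⟩
  invFun A := ⟨P⁻¹ᵀ * A.1 * P⁻¹, isSymm_congruence A.2 _⟩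
  left_inv A := Subtype.ext (by
    simp only [← Matrix.mul_assoc, ← transpose_mul, Matrix.mul_nonsing_inv _ hP]
    simp [Matrix.mul_assoc, Matrix.mul_nonsing_inv _ hP])
  right_inv A := Subtype.ext (by
    simp only [← Matrix.mul_assoc, ← transpose_mul, Matrix.nonsing_inv_mul _ hP]
    simp [Matrix.mul_assoc, Matrix.nonsing_inv_mul _ hP])

variable [Fintype F]

/-- The sum of `quadSum ψ A` over all symmetric matrices `A` of rank `k`. -/
noncomputable def rankQuadSum (ψ : AddChar F ℂ) (ι : Type*) [Fintype ι]
    [DecidableEq ι] (k : ℕ) : ℂ :=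
  ∑ A : SymmMatrix ι F, if A.1.rank = k then quadSum ψ A.1 else 0

theorem quadSum_submatrix (ψ : AddChar F ℂ) (A : Matrix κ κ F) (e : ι ≃ κ) :
    quadSum ψ (A.submatrix e e) = quadSum ψ A := by
  refine Fintype.sum_equiv (e.arrowCongr (Equiv.refl F)) _ _ fun X => ?_
  rw [submatrix_mulVec_equiv, ← comp_equiv_symm_dotProduct]
  rfl

theorem rankQuadSum_congr (ψ : AddChar F ℂ) (e : ι ≃ κ) (k : ℕ) :
    rankQuadSum ψ ι k = rankQuadSum ψ κ k := by
  refine (Fintype.sum_equiv (SymmMatrix.reindex e) _ _ fun A => ?_).symm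
  change _ = if (A.1.submatrix e e).rank = k then quadSum ψ (A.1.submatrix e e) else 0
  rw [rank_submatrix, quadSum_submatrix]

theorem rankQuadSum_of_odd {ψ : AddChar F ℂ} (hψ : ψ.IsPrimitive) (hF : ringChar F ≠ 2) {k : ℕ}
    (hk : Odd k) : rankQuadSum ψ ι k = 0 := by
  obtain ⟨n, hn⟩ := FiniteField.exists_nonsquare hF
  have hn0 : n ≠ 0 := by rintro rfl; exact hn (.zero)
  have h : -rankQuadSum ψ ι k = rankQuadSum ψ ι k := by
    rw [rankQuadSum, ← Finset.sum_neg_distrib]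
    refine Fintype.sum_equiv (SymmMatrix.smulEquiv n hn0) _ _ fun A => ?_
    change _ = if (n • A.1).rank = k then quadSum ψ (n • A.1) else 0
    rw [rank_smul_of_mem_nonZeroDivisors _ (mem_nonZeroDivisors_of_ne_zero hn0),
      quadSum_smul_of_not_isSquare hψ hF hn A.2]
    split_ifs with hA
    · rw [hA, hk.neg_one_pow, neg_one_mul]
    · exact neg_zero
  exact self_eq_neg.1 h.symm

variable [DecidableEq F]

theorem rankExcess_mulVec (ψ : AddChar F ℂ) (k : ℕ) {P : Matrix ι ι F} (hP : IsUnit P.det)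
    (X : ι → F) : rankExcess ψ k (P *ᵥ X) = rankExcess ψ k X := by
  refine Fintype.sum_equiv (SymmMatrix.congruence P hP) _ _ fun A => ?_
  have hinj : Function.Injective Pᵀ.mulVec :=
    (mulVecEquiv Pᵀ (by rwa [det_transpose])).injective
  simp only [SymmMatrix.congruence, Equiv.coe_fn_mk, rank_congruence _ hP, dotProduct_congruence]
  simp only [← mulVec_mulVec, hinj.eq_iff' (mulVec_zero _)]

theorem sum_rankExcess (ψ : AddChar F ℂ) (k : ℕ) :
    (Fintype.card F : ℂ) ^ k * ∑ X : ι → F, rankExcess ψ k X =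
      (Fintype.card F : ℂ) ^ k * rankQuadSum ψ ι k -
        (Fintype.card F : ℂ) ^ Fintype.card ι * rankCount F ι k := by
  simp_rw [rankExcess]
  rw [Finset.sum_comm, rankQuadSum, rankCount, Finset.mul_sum, Finset.mul_sum, Finset.mul_sum,
    ← Finset.sum_sub_distrib]
  refine Finset.sum_congr rfl fun A _ => ?_
  split_ifs with hA
  · have h := card_mulVec_eq_zero_mul A.1
    rw [hA] at h
    rw [Finset.sum_sub_distrib, mul_sub, Finset.sum_boole, mul_comm _ (Nat.cast _), mul_one]
    rw [quadSum]
    congr 1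
    exact_mod_cast h
  · simp

theorem rankQuadSum_of_rankExcess_eq_zero {ψ : AddChar F ℂ} {k : ℕ} {X : ι → F} (hX : X ≠ 0)
    (h : rankExcess ψ k X = 0) :
    (Fintype.card F : ℂ) ^ k * rankQuadSum ψ ι k =
      (Fintype.card F : ℂ) ^ Fintype.card ι * rankCount F ι k := by
  rw [← sub_eq_zero, ← sum_rankExcess, Finset.sum_eq_zero, mul_zero]
  intro Y _
  rcases eq_or_ne Y 0 with rfl | hY
  · exact rankExcess_zero ψ k
  · obtain ⟨P, hP, rfl⟩ := exists_isUnit_det_mulVec_eq hX hY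
    rw [rankExcess_mulVec ψ k hP, h]

theorem rankExcess_inl (ψ : AddChar F ℂ) (h2 : (2 : F) ≠ 0) (k : ℕ) :
    rankExcess ψ k (Sum.elim 1 0 : Unit ⊕ ι → F) =
      (∑ B : SymmMatrix ι F, ∑ v, ∑ a, if (bordered a v B.1).rank = k then ψ a else 0) -
        rankCount F ι k := by
  rw [rankExcess, ← SymmMatrix.borderedEquiv.sum_comp, Fintype.sum_prod_type, rankCount,
    ← Finset.sum_sub_distrib]
  refine Finset.sum_congr rfl fun B _ => ?_
  have hvec (a : F) (v : ι → F) :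
      bordered a v B.1 *ᵥ Sum.elim 1 0 = Sum.elim (fun _ => a) v := by
    rw [bordered, fromBlocks_mulVec]
    congr 1
    · ext
      simp [mulVec, dotProduct]
    · ext
      simp [mulVec, dotProduct]
  have hzero (a : F) (v : ι → F) :
      (Sum.elim (fun _ => a) v : Unit ⊕ ι → F) = 0 ↔ v = 0 ∧ a = 0 := by
    rw [← Sum.elim_zero_zero, Sum.elim_eq_iff, and_comm, funext_iff (f := fun _ => a)]
    simp
  have hdot (a : F) (v : ι → F) :
      (Sum.elim 1 0 : Unit ⊕ ι → F) ⬝ᵥ Sum.elim (fun _ => a) v = a := by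
    simp [dotProduct]
  have hrank := rank_bordered_zero h2 0 B.2
  rw [if_pos rfl, add_zero] at hrank
  simp only [Fintype.sum_prod_type, SymmMatrix.coe_borderedEquiv, hvec, hdot, hzero]
  have hsplit (a : F) (v : ι → F) :
      (if (bordered a v B.1).rank = k then ψ a - (if v = 0 ∧ a = 0 then 1 else 0) else 0) =
        (if (bordered a v B.1).rank = k then ψ a else 0) -
          if v = 0 then if a = 0 then if B.1.rank = k then 1 else 0 else 0 else 0 := by
    by_cases hva : v = 0 ∧ a = 0
    · obtain ⟨rfl, rfl⟩ := hva
      simp only [hrank, and_self, if_true]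
      by_cases hB : B.1.rank = k <;> simp [hB]
    · rw [if_neg hva, sub_zero]
      split_ifs <;> simp_all
  simp_rw [hsplit, Finset.sum_sub_distrib]
  congr 1
  rw [Finset.sum_comm]
  simp

theorem pow_mul_rankQuadSum {ψ : AddChar F ℂ} (hψ : ψ.IsPrimitive) (hF : ringChar F ≠ 2) {k : ℕ}
    (hk : Even k) (m : ℕ) :
    (Fintype.card F : ℂ) ^ k * rankQuadSum ψ (Fin m) k =
      (Fintype.card F : ℂ) ^ m * rankCount F (Fin m) k := by
  have h2 : (2 : F) ≠ 0 := Ring.two_ne_zero hF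
  have hq : (Fintype.card F : ℂ) ≠ 0 := Nat.cast_ne_zero.2 Fintype.card_ne_zero
  induction m with
  | zero =>
    rw [rankQuadSum, rankCount, Finset.mul_sum, Finset.mul_sum]
    refine Finset.sum_congr rfl fun A _ => ?_
    have hA : A.1.rank = 0 := Nat.le_zero.1 (rank_le_width A.1)
    rw [hA]
    split_ifs with h
    · simp [← h, quadSum]
    · simp
  | succ m ih =>
    let e : Unit ⊕ Fin m ≃ Fin (m + 1) := Fintype.equivOfCardEq (by simp [add_comm])
    have hcard : Fintype.card (Unit ⊕ Fin m) = m + 1 := by simp [add_comm]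
    rw [← rankQuadSum_congr ψ e, ← rankCount_congr e]
    conv_rhs => rw [← hcard]
    refine rankQuadSum_of_rankExcess_eq_zero (X := Sum.elim 1 0)
      (fun h => one_ne_zero (congrFun h (Sum.inl ()))) ?_
    rw [rankExcess_inl ψ h2, sub_eq_zero]
    refine mul_left_cancel₀ (pow_ne_zero m hq) ?_
    rw [← ih, Finset.mul_sum]
    have key (B : SymmMatrix (Fin m) F) := sum_sum_rank_bordered hψ h2 B.2 k
    rw [Fintype.card_fin] at key
    simp_rw [key]
    have hodd : ∑ B : SymmMatrix (Fin m) F,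
        (if B.1.rank + 1 = k then (Fintype.card F : ℂ) ^ B.1.rank * quadSum ψ B.1 else 0) = 0 := by
      cases k with
      | zero => simp
      | succ k =>
        refine Eq.trans ?_ (mul_eq_zero_of_right ((Fintype.card F : ℂ) ^ k)
          (rankQuadSum_of_odd (ι := Fin m) hψ hF (Nat.not_even_iff_odd.1 (Nat.even_add_one.1 hk))))
        rw [rankQuadSum, Finset.mul_sum]
        refine Finset.sum_congr rfl fun B _ => ?_
        split_ifs <;> simp_all
    rw [← sub_zero (_ ^ k * _), ← hodd, rankQuadSum, Finset.mul_sum, ← Finset.sum_sub_distrib]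
    refine Finset.sum_congr rfl fun B _ => ?_
    split_ifs <;> simp_all

end SymmMatrix

section Types

variable {F : Type*} [Field F] [Fintype F] {m r : ℕ} {A : Matrix (Fin m) (Fin m) F}
  {ψ : AddChar F ℂ}

theorem isHyp_iff_quadSum_eq (hψ : ψ.IsPrimitive) (hF : ringChar F ≠ 2) (h : 2 * r ≤ m) :
    IsHyp A r ↔ quadSum ψ A = (Fintype.card F : ℂ) ^ (m - r) := by
  refine ⟨fun ⟨k, hk, hA⟩ => ?_, fun hA => ⟨1, one_ne_zero, ?_⟩⟩
  · rw [hA.quadSum_eq, quadSum_smul_stdHyp hψ hk h]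
  · refine quadEquiv_of_equivalent (equivalent_of_quadSum_eq hψ hF ?_)
    rw [hA, quadSum_smul_stdHyp hψ one_ne_zero h]

theorem isEll_iff_quadSum_eq (hψ : ψ.IsPrimitive) (hF : ringChar F ≠ 2) (hr : 1 ≤ r)
    (h : 2 * r ≤ m) : IsEll A r ↔ quadSum ψ A = -(Fintype.card F : ℂ) ^ (m - r) := by
  refine ⟨fun ⟨k, a, b, c, hk, hD, hA⟩ => ?_, fun hA => ?_⟩
  · rw [hA.quadSum_eq, quadSum_smul_stdEll hψ hF hk hD hr h]
  · obtain ⟨n, hn⟩ := FiniteField.exists_nonsquare hF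
    have hD : ¬ IsSquare ((0 : F) ^ 2 - 4 * 1 * -n) := by
      rintro ⟨x, hx⟩
      have h2 : (2 : F) ≠ 0 := Ring.two_ne_zero hF
      refine hn ⟨x / 2, ?_⟩
      field_simp
      linear_combination hx
    refine ⟨1, 1, 0, -n, one_ne_zero, hD,
      quadEquiv_of_equivalent (equivalent_of_quadSum_eq hψ hF ?_)⟩
    rw [hA, quadSum_smul_stdEll hψ hF one_ne_zero hD hr h]

open Classical in
theorem natCast_card_symmMatrix (k : ℕ) (p : Matrix (Fin m) (Fin m) F → Prop) :
    (Nat.card {A : Matrix (Fin m) (Fin m) F // A.IsSymm ∧ A.rank = k ∧ p A} : ℂ) =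
      ∑ A : SymmMatrix (Fin m) F, if A.1.rank = k then if p A.1 then 1 else 0 else 0 := by
  simp_rw [← ite_and]
  rw [Finset.sum_boole, ← Fintype.card_subtype, ← Nat.card_eq_fintype_card]
  exact congrArg _ (Nat.card_congr (Equiv.subtypeSubtypeEquivSubtypeInter IsSymm
    fun A => A.rank = k ∧ p A).symm)

theorem natCast_card_symmMatrix_rank (k : ℕ) :
    (Nat.card {A : Matrix (Fin m) (Fin m) F // A.IsSymm ∧ A.rank = k} : ℂ) =
      rankCount F (Fin m) k := by
  simpa [rankCount] using natCast_card_symmMatrix (F := F) (m := m) k fun _ => True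

theorem rankQuadSum_eq_mul_sub (hψ : ψ.IsPrimitive) (hF : ringChar F ≠ 2) (hr : 1 ≤ r)
    (h : 2 * r ≤ m) :
    rankQuadSum ψ (Fin m) (2 * r) = (Fintype.card F : ℂ) ^ (m - r) *
      (Nat.card {A : Matrix (Fin m) (Fin m) F // A.IsSymm ∧ A.rank = 2 * r ∧ IsHyp A r} -
        Nat.card {A : Matrix (Fin m) (Fin m) F // A.IsSymm ∧ A.rank = 2 * r ∧ IsEll A r}) := by
  have hq : (Fintype.card F : ℂ) ^ (m - r) ≠ 0 :=
    pow_ne_zero _ (Nat.cast_ne_zero.2 Fintype.card_ne_zero)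
  rw [natCast_card_symmMatrix, natCast_card_symmMatrix, ← Finset.sum_sub_distrib, Finset.mul_sum,
    rankQuadSum]
  refine Finset.sum_congr rfl fun A _ => ?_
  simp only [isHyp_iff_quadSum_eq hψ hF h, isEll_iff_quadSum_eq hψ hF hr h]
  split_ifs with hA hp hn hn
  · exact absurd (hp.symm.trans hn) (mt self_eq_neg.1 hq)
  · rw [hp, sub_zero, mul_one]
  · rw [hn, zero_sub, mul_neg_one]
  · have := quadSum_eq_or_eq_neg hψ hF A.2 hA
    rw [Fintype.card_fin] at this
    exact absurd this (not_or.2 ⟨hp, hn⟩)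
  · simp

end Types

/-- `v₊(2r,m) − v₋(2r,m) = q^{−r} · s(2r,m)`, where `v₊` and `v₋` count hyperbolic and
elliptic symmetric matrices of rank `2r` and `s(2r,m)` counts all symmetric matrices of
rank `2r`. -/
theorem hyp_minus_ell (F : Type*) [Field F] [Fintype F] (hq : Odd (Fintype.card F))
    (m r : ℕ) (hr : 1 ≤ r) (hrm : 2 * r ≤ m) :
    (Nat.card {A : Matrix (Fin m) (Fin m) F // A.IsSymm ∧ A.rank = 2 * r ∧ IsHyp A r} : ℚ) -
      (Nat.card {A : Matrix (Fin m) (Fin m) F // A.IsSymm ∧ A.rank = 2 * r ∧ IsEll A r} : ℚ) =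
    (Fintype.card F : ℚ) ^ (-(r : ℤ)) *
      (Nat.card {A : Matrix (Fin m) (Fin m) F // A.IsSymm ∧ A.rank = 2 * r} : ℚ) := by
  have hF : ringChar F ≠ 2 := fun h =>
    Nat.not_even_iff_odd.2 hq (Nat.even_iff.2 (FiniteField.even_card_iff_char_two.1 h))
  have hψ := AddChar.FiniteField.primitiveChar_to_Complex_isPrimitive F
  have hq0 : (Fintype.card F : ℂ) ≠ 0 := Nat.cast_ne_zero.2 Fintype.card_ne_zero
  have hpow : (Fintype.card F : ℂ) ^ m =
      (Fintype.card F : ℂ) ^ (m - r) * (Fintype.card F : ℂ) ^ r := by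
    rw [← pow_add, Nat.sub_add_cancel (by omega)]
  classical
  have key := pow_mul_rankQuadSum hψ hF (even_two_mul r) m
  rw [rankQuadSum_eq_mul_sub hψ hF hr hrm, ← natCast_card_symmMatrix_rank, hpow] at key
  apply Rat.cast_injective (α := ℂ)
  push_cast
  rw [_root_.zpow_neg, _root_.zpow_natCast, eq_inv_mul_iff_mul_eq₀ (pow_ne_zero r hq0)]
  refine mul_left_cancel₀ (mul_ne_zero (pow_ne_zero (m - r) hq0) (pow_ne_zero r hq0)) ?_
  linear_combination key
end

section
/- Let q be odd, B a symmetric (m−1)×(m−1) matrix over F_q of rank 2t−2, and A a symmetric m×m matrix of rank 2t whose deletion of the first row and first column equals B. Then A is hyperbolic if and only if B is hyperbolic, and A is elliptic if and only if B is elliptic. -/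
open Matrix

theorem mulVec_eq_zero_of_quadForm_add_eq {F : Type*} [Field F] (h2 : (2 : F) ≠ 0) {n : ℕ}
    {A : Matrix (Fin n) (Fin n) F} (hA : A.IsSymm) {w : Fin n → F}
    (hw : ∀ X, (X + w) ⬝ᵥ A *ᵥ (X + w) = X ⬝ᵥ A *ᵥ X) : A *ᵥ w = 0 := by
  have h0 : w ⬝ᵥ A *ᵥ w = 0 := by simpa using hw 0
  refine dotProduct_eq_zero _ fun X => ?_
  have hs : w ⬝ᵥ A *ᵥ X = X ⬝ᵥ A *ᵥ w := by
    rw [dotProduct_mulVec, ← mulVec_transpose, hA.eq, dotProduct_comm]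
  have h := hw X
  simp only [mulVec_add, dotProduct_add, add_dotProduct, h0, hs, add_zero] at h
  have h' : 2 * (X ⬝ᵥ A *ᵥ w) = 0 := by linear_combination h
  rw [dotProduct_comm]
  exact (mul_eq_zero.1 h').resolve_left h2

theorem quadForm_add_of_mulVec_eq_zero {F : Type*} [Field F] {n : ℕ}
    {A : Matrix (Fin n) (Fin n) F} (hA : A.IsSymm) {w : Fin n → F} (hw : A *ᵥ w = 0)
    (X : Fin n → F) : (X + w) ⬝ᵥ A *ᵥ (X + w) = X ⬝ᵥ A *ᵥ X := by
  have hs : w ⬝ᵥ A *ᵥ X = X ⬝ᵥ A *ᵥ w := by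
    rw [dotProduct_mulVec, ← mulVec_transpose, hA.eq, dotProduct_comm]
  simp [mulVec_add, add_dotProduct, hw, hs]

theorem finrank_ker_mulVecLin_add_rank {F : Type*} [Field F] {n : ℕ}
    (A : Matrix (Fin n) (Fin n) F) :
    A.rank + Module.finrank F (LinearMap.ker A.mulVecLin) = n := by
  have := A.mulVecLin.finrank_range_add_finrank_ker
  simpa [Matrix.rank] using this

/-- Functionals whose common kernel lies in the radical of a form of rank `2r` are the first
`2r` rows of an invertible matrix. -/
theorem exists_isUnit_det_rows {F : Type*} [Field F] {n r : ℕ}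
    {A : Matrix (Fin n) (Fin n) F} (hr : A.rank = 2 * r) (hn : 2 * r ≤ n)
    (p q : Fin r → (Fin n → F) →ₗ[F] F)
    (hker : ∀ X, (∀ i, p i X = 0) → (∀ i, q i X = 0) → A *ᵥ X = 0) :
    ∃ L : Matrix (Fin n) (Fin n) F, IsUnit L.det ∧ ∀ X, ∀ i : Fin r,
      (L *ᵥ X) ⟨2 * i, by omega⟩ = p i X ∧ (L *ᵥ X) ⟨2 * i + 1, by omega⟩ = q i X := by
  classical
  let g : Fin r ⊕ Fin r → (Fin n → F) →ₗ[F] F := Sum.elim p q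
  let G : (Fin n → F) →ₗ[F] (Fin r ⊕ Fin r → F) := LinearMap.pi g
  have hle : LinearMap.ker G ≤ LinearMap.ker A.mulVecLin := by
    intro X hX
    have hX' : ∀ s, g s X = 0 := fun s => congrFun (LinearMap.mem_ker.1 hX) s
    exact hker X (fun i => hX' (Sum.inl i)) (fun i => hX' (Sum.inr i))
  have hsurj : Function.Surjective G := by
    rw [← LinearMap.range_eq_top]
    apply Submodule.eq_top_of_finrank_eq
    have h1 := finrank_ker_mulVecLin_add_rank A
    have h2 := G.finrank_range_add_finrank_ker
    have h3 := Submodule.finrank_mono hle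
    have h4 := (LinearMap.range G).finrank_le
    simp only [Module.finrank_fintype_fun_eq_card, Fintype.card_sum, Fintype.card_fin] at *
    omega
  have hli : LinearIndependent F g := by
    rw [Fintype.linearIndependent_iff]
    intro c hc s
    obtain ⟨X, hX⟩ := hsurj (Pi.single s 1)
    have hX' : ∀ s', g s' X = (Pi.single s 1 : Fin r ⊕ Fin r → F) s' := fun s' => congrFun hX s'
    have := LinearMap.congr_fun hc X
    simpa [hX', Pi.single_apply, -Fintype.sum_sum_type] using this
  let b := Module.Basis.sumExtend hli
  have hb : ∀ s, b (Sum.inl s) = g s := fun s => by simp [b, Module.Basis.sumExtend]; rfl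
  have : Finite ((Fin r ⊕ Fin r) ⊕ Module.Basis.sumExtendIndex hli) :=
    Module.Finite.finite_basis b
  have : Fintype (Module.Basis.sumExtendIndex hli) :=
    @Fintype.ofFinite _ (Finite.of_injective (Sum.inr (α := Fin r ⊕ Fin r)) Sum.inr_injective)
  have hcard := Module.finrank_eq_card_basis b
  simp only [Subspace.dual_finrank_eq, Module.finrank_fintype_fun_eq_card, Fintype.card_sum,
    Fintype.card_fin] at hcard
  let pos : Fin r ⊕ Fin r → Fin n :=
    Sum.elim (fun i => ⟨2 * i, by omega⟩) (fun i => ⟨2 * i + 1, by omega⟩)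
  have hpos : Function.Injective pos := by
    rintro (i | i) (j | j) h <;> simp [pos, Fin.ext_iff] at h ⊢ <;> omega
  obtain ⟨e, he⟩ : ∃ e : (Fin r ⊕ Fin r) ⊕ Module.Basis.sumExtendIndex hli ≃ Fin n,
      ∀ s, e (Sum.inl s) = pos s := by
    have hc : Fintype.card (Module.Basis.sumExtendIndex hli) =
        Fintype.card ((Set.range pos)ᶜ : Set (Fin n)) := by
      rw [Fintype.card_compl_set, Set.card_range_of_injective hpos]
      simp only [Fintype.card_sum, Fintype.card_fin]
      omega
    let e' := Fintype.equivOfCardEq hc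
    refine ⟨(Equiv.sumCongr (Equiv.ofInjective pos hpos) e').trans
      (Equiv.Set.sumCompl _), fun s => by simp⟩
  let L : (Fin n → F) →ₗ[F] (Fin n → F) := LinearMap.pi (b.reindex e)
  have hL : ∀ X s, L X (pos s) = g s X := fun X s => by simp [L, ← he, hb]
  have hinj : Function.Injective L := by
    rw [← LinearMap.ker_eq_bot, LinearMap.ker_eq_bot']
    intro X hX
    have : Module.Dual.eval F (Fin n → F) X = 0 :=
      (b.reindex e).ext fun i => congrFun hX i
    exact (Module.forall_dual_apply_eq_zero_iff F X).1 fun f => LinearMap.congr_fun this f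
  refine ⟨LinearMap.toMatrix' L, ?_, fun X i => ?_⟩
  · rw [← Matrix.isUnit_iff_isUnit_det, ← Matrix.mulVec_injective_iff_isUnit]
    intro X Y h
    apply hinj
    simpa [LinearMap.toMatrix'_mulVec] using h
  · rw [LinearMap.toMatrix'_mulVec]
    exact ⟨hL X (Sum.inl i), hL X (Sum.inr i)⟩

theorem quadForm_stdHyp {F : Type*} [Field F] {n : ℕ} (r : ℕ) (hn : 2 * r ≤ n) (Y : Fin n → F) :
    Y ⬝ᵥ stdHyp F n r *ᵥ Y =
      ∑ i : Fin r, Y ⟨2 * i, by omega⟩ * Y ⟨2 * i + 1, by omega⟩ := by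
  induction r with
  | zero =>
    have : stdHyp F n 0 = 0 := by ext i j; simp [stdHyp]
    simp [this]
  | succ r ih =>
    have : stdHyp F n (r + 1) = stdHyp F n r +
        Matrix.single ⟨2 * r, by omega⟩ ⟨2 * r + 1, by omega⟩ 1 := by
      ext i j
      simp only [stdHyp, Matrix.of_apply, Matrix.add_apply, Matrix.single_apply, Fin.ext_iff]
      split_ifs <;> first | omega | simp
    rw [this, add_mulVec, dotProduct_add, ih (by omega), Fin.sum_univ_castSucc]
    simp [single_mulVec, Function.update_apply, dotProduct]

theorem quadForm_stdEll {F : Type*} [Field F] {n : ℕ} (s : ℕ) (hn : 2 * (s + 1) ≤ n) (a b c : F)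
    (Y : Fin n → F) :
    Y ⬝ᵥ stdEll F n (s + 1) a b c *ᵥ Y =
      a * Y ⟨0, by omega⟩ ^ 2 + b * Y ⟨0, by omega⟩ * Y ⟨1, by omega⟩ + c * Y ⟨1, by omega⟩ ^ 2 +
      ∑ i : Fin s, Y ⟨2 * (i + 1), by omega⟩ * Y ⟨2 * (i + 1) + 1, by omega⟩ := by
  induction s with
  | zero =>
    have : stdEll F n (0 + 1) a b c = Matrix.single ⟨0, by omega⟩ ⟨0, by omega⟩ a +
        Matrix.single ⟨0, by omega⟩ ⟨1, by omega⟩ b +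
        Matrix.single ⟨1, by omega⟩ ⟨1, by omega⟩ c := by
      ext i j
      simp only [stdEll, Matrix.of_apply, Matrix.add_apply, Matrix.single_apply, Fin.ext_iff]
      split_ifs <;> first | omega | simp
    rw [this, add_mulVec, add_mulVec, dotProduct_add, dotProduct_add]
    simp [single_mulVec, Function.update_apply, dotProduct]
    ring
  | succ s ih =>
    have : stdEll F n (s + 1 + 1) a b c = stdEll F n (s + 1) a b c +
        Matrix.single ⟨2 * (s + 1), by omega⟩ ⟨2 * (s + 1) + 1, by omega⟩ 1 := by
      ext i j
      simp only [stdEll, Matrix.of_apply, Matrix.add_apply, Matrix.single_apply, Fin.ext_iff]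
      split_ifs <;> first | omega | simp
    rw [this, add_mulVec, dotProduct_add, ih (by omega), Fin.sum_univ_castSucc]
    simp [single_mulVec, Function.update_apply, dotProduct]
    ring

theorem isHyp_iff_exists_functionals {F : Type*} [Field F] (h2 : (2 : F) ≠ 0) {n r : ℕ}
    {A : Matrix (Fin n) (Fin n) F} (hA : A.IsSymm) (hr : A.rank = 2 * r) :
    IsHyp A r ↔ ∃ k : F, k ≠ 0 ∧ ∃ p q : Fin r → (Fin n → F) →ₗ[F] F,
      ∀ X, X ⬝ᵥ A *ᵥ X = k * ∑ i, p i X * q i X := by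
  have hn : 2 * r ≤ n := hr ▸ A.rank_le_width
  constructor
  · rintro ⟨k, hk, L, -, hL⟩
    refine ⟨k, hk, fun i => LinearMap.proj ⟨2 * i, by omega⟩ ∘ₗ L.mulVecLin,
      fun i => LinearMap.proj ⟨2 * i + 1, by omega⟩ ∘ₗ L.mulVecLin, fun X => ?_⟩
    rw [hL, smul_mulVec, dotProduct_smul, quadForm_stdHyp r hn]
    simp
  · rintro ⟨k, hk, p, q, h⟩
    obtain ⟨L, hdet, hL⟩ := exists_isUnit_det_rows hr hn p q fun X hp hq =>
      mulVec_eq_zero_of_quadForm_add_eq h2 hA fun Y => by simp [h, hp, hq]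
    refine ⟨k, hk, L, hdet, fun X => ?_⟩
    rw [smul_mulVec, dotProduct_smul, quadForm_stdHyp r hn, h]
    simp [hL]

theorem isEll_iff_exists_functionals {F : Type*} [Field F] (h2 : (2 : F) ≠ 0) {n s : ℕ}
    {A : Matrix (Fin n) (Fin n) F} (hA : A.IsSymm) (hr : A.rank = 2 * (s + 1)) :
    IsEll A (s + 1) ↔ ∃ k a b c : F, k ≠ 0 ∧ ¬ IsSquare (b ^ 2 - 4 * a * c) ∧
      ∃ (u v : (Fin n → F) →ₗ[F] F) (p q : Fin s → (Fin n → F) →ₗ[F] F),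
      ∀ X, X ⬝ᵥ A *ᵥ X =
        k * (a * u X ^ 2 + b * u X * v X + c * v X ^ 2 + ∑ i, p i X * q i X) := by
  have hn : 2 * (s + 1) ≤ n := hr ▸ A.rank_le_width
  constructor
  · rintro ⟨k, a, b, c, hk, hd, L, -, hL⟩
    refine ⟨k, a, b, c, hk, hd, LinearMap.proj ⟨0, by omega⟩ ∘ₗ L.mulVecLin,
      LinearMap.proj ⟨1, by omega⟩ ∘ₗ L.mulVecLin,
      fun i => LinearMap.proj ⟨2 * (i + 1), by omega⟩ ∘ₗ L.mulVecLin,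
      fun i => LinearMap.proj ⟨2 * (i + 1) + 1, by omega⟩ ∘ₗ L.mulVecLin, fun X => ?_⟩
    rw [hL, smul_mulVec, dotProduct_smul, quadForm_stdEll s hn]
    simp
  · rintro ⟨k, a, b, c, hk, hd, u, v, p, q, h⟩
    obtain ⟨L, hdet, hL⟩ := exists_isUnit_det_rows hr hn (Fin.cons u p) (Fin.cons v q)
      fun X hp hq => mulVec_eq_zero_of_quadForm_add_eq h2 hA fun Y => by
        rw [Fin.forall_fin_succ] at hp hq
        simp only [Fin.cons_zero, Fin.cons_succ] at hp hq
        simp [h, hp, hq]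
    refine ⟨k, a, b, c, hk, hd, L, hdet, fun X => ?_⟩
    have h0 := hL X 0
    have hs := fun i : Fin s => hL X i.succ
    simp only [Fin.cons_zero, Fin.cons_succ, Fin.val_zero, Fin.val_succ, mul_zero, zero_add]
      at h0 hs
    rw [smul_mulVec, dotProduct_smul, quadForm_stdEll s hn, h]
    simp [h0, hs]

theorem eq_zero_of_binary_form_eq_zero {F : Type*} [Field F] {a b c x y : F}
    (hd : ¬ IsSquare (b ^ 2 - 4 * a * c)) (h : a * x ^ 2 + b * x * y + c * y ^ 2 = 0) :
    x = 0 ∧ y = 0 := by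
  have ha : a ≠ 0 := by
    rintro rfl
    exact hd ⟨b, by ring⟩
  have hy : y = 0 := by
    by_contra hy
    refine hd ⟨(2 * a * x + b * y) / y, ?_⟩
    field_simp
    linear_combination -4 * a * h
  subst hy
  simpa [ha] using h

theorem not_isEll_zero {F : Type*} [Field F] {n : ℕ} (hn : n ≠ 0)
    {A : Matrix (Fin n) (Fin n) F} (hr : A.rank = 0) : ¬ IsEll A 0 := by
  rintro ⟨k, a, b, c, hk, hd, L, hdet, hL⟩
  obtain ⟨n, rfl⟩ := Nat.exists_eq_succ_of_ne_zero hn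
  obtain rfl : A = 0 := by
    rw [Matrix.rank, Submodule.finrank_eq_zero, LinearMap.range_eq_bot] at hr
    exact Matrix.ext_of_mulVec_single fun i => by
      rw [zero_mulVec]
      exact LinearMap.congr_fun hr (Pi.single i 1)
  have h := hL (L⁻¹ *ᵥ Pi.single 0 1)
  rw [zero_mulVec, mulVec_mulVec, Matrix.mul_nonsing_inv L hdet, one_mulVec] at h
  have ha : a = 0 := by simpa [stdEll, smul_mulVec, hk] using h
  subst ha
  exact hd ⟨b, by ring⟩

theorem exists_mulVec_eq_zero_of_rank_border {F : Type*} [Field F] {m s : ℕ}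
    {A : Matrix (Fin (m + 1)) (Fin (m + 1)) F} (hrA : A.rank = 2 * (s + 1))
    {B : Matrix (Fin m) (Fin m) F} (hrB : B.rank = 2 * s) :
    ∃ w, B *ᵥ w = 0 ∧ A *ᵥ Fin.cons 0 w ≠ 0 := by
  by_contra! h
  let f : (Fin m → F) →ₗ[F] (Fin (m + 1) → F) := LinearMap.pi (Fin.cons 0 LinearMap.proj)
  have hf : ∀ y, f y = Fin.cons 0 y := fun y => by
    ext i
    cases i using Fin.cases <;> simp [f]
  have hinj : Function.Injective f := fun x y hxy => by
    rw [hf, hf] at hxy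
    exact (Fin.cons_inj.1 hxy).2
  have hle : (LinearMap.ker B.mulVecLin).map f ≤ LinearMap.ker A.mulVecLin := by
    rintro _ ⟨w, hw, rfl⟩
    rw [hf]
    exact h w hw
  have h1 := finrank_ker_mulVecLin_add_rank A
  have h2 := finrank_ker_mulVecLin_add_rank B
  have h3 := Submodule.finrank_mono hle
  rw [← (Submodule.equivMapOfInjective f hinj _).finrank_eq] at h3
  omega

theorem quadForm_cons {F : Type*} [Field F] {m : ℕ}
    {A : Matrix (Fin (m + 1)) (Fin (m + 1)) F} (hA : A.IsSymm) (x : F) (y : Fin m → F) :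
    (Fin.cons x y : Fin (m + 1) → F) ⬝ᵥ A *ᵥ Fin.cons x y =
      x * (A 0 0 * x + 2 * ∑ j, A 0 (Fin.succ j) * y j) +
        y ⬝ᵥ A.submatrix Fin.succ Fin.succ *ᵥ y := by
  simp only [dotProduct, mulVec, Fin.sum_univ_succ, Fin.cons_zero, Fin.cons_succ, submatrix_apply,
    fun i : Fin m => hA.apply 0 i.succ, mul_add, Finset.sum_add_distrib, Finset.mul_sum]
  have : ∑ i, y i * (A 0 (Fin.succ i) * x) = ∑ i, x * (A 0 (Fin.succ i) * y i) :=
    Finset.sum_congr rfl fun i _ => by ring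
  rw [this]
  have : ∑ i, x * (2 * (A 0 (Fin.succ i) * y i)) = 2 * ∑ i, x * (A 0 (Fin.succ i) * y i) := by
    rw [Finset.mul_sum]
    exact Finset.sum_congr rfl fun i _ => by ring
  rw [this]
  ring

theorem two_ne_zero_of_odd_card {F : Type*} [Field F] [Fintype F] (hq : Odd (Fintype.card F)) :
    (2 : F) ≠ 0 := by
  refine Ring.two_ne_zero fun h => ?_
  have := FiniteField.even_card_of_char_two h
  rcases hq with ⟨c, hc⟩
  omega

/-- If `w` is a radical vector on which some functional `f` does not vanish, then the projection
along `w` onto the kernel of `f` preserves the form. -/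
theorem exists_projection_of_mulVec_eq_zero {F : Type*} [Field F] {n : ℕ}
    {B : Matrix (Fin n) (Fin n) F} (hB : B.IsSymm) {w : Fin n → F} (hw : B *ᵥ w = 0)
    (f : (Fin n → F) →ₗ[F] F) (hf : f w ≠ 0) :
    ∃ π : (Fin n → F) →ₗ[F] (Fin n → F), (∀ X, f (π X) = 0) ∧
      ∀ X, π X ⬝ᵥ B *ᵥ π X = X ⬝ᵥ B *ᵥ X := by
  refine ⟨LinearMap.id - ((f w)⁻¹ • f).smulRight w, fun X => ?_, fun X => ?_⟩
  · simp only [LinearMap.sub_apply, LinearMap.id_apply, LinearMap.smulRight_apply,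
      LinearMap.smul_apply, smul_eq_mul, map_sub, map_smul]
    field_simp
    ring
  · have h : B *ᵥ (-((f w)⁻¹ * f X) • w) = 0 := by rw [mulVec_smul, hw, smul_zero]
    have := quadForm_add_of_mulVec_eq_zero hB h X
    simpa [sub_eq_add_neg] using this

/-- Projecting along a radical vector removes one product from a sum of products of functionals,
provided some functional of the sum does not vanish on that vector. -/
theorem exists_projection_sum_succAbove {F : Type*} [Field F] {n s : ℕ}
    {B : Matrix (Fin n) (Fin n) F} (hB : B.IsSymm) {w : Fin n → F} (hw : B *ᵥ w = 0)
    (p q : Fin (s + 1) → (Fin n → F) →ₗ[F] F) {j : Fin (s + 1)} (hj : p j w ≠ 0 ∨ q j w ≠ 0) :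
    ∃ π : (Fin n → F) →ₗ[F] (Fin n → F), (∀ X, π X ⬝ᵥ B *ᵥ π X = X ⬝ᵥ B *ᵥ X) ∧
      ∀ X, ∑ i, p i (π X) * q i (π X) =
        ∑ i, p (j.succAbove i) (π X) * q (j.succAbove i) (π X) := by
  rcases hj with hj | hj
  · obtain ⟨π, h0, hπ⟩ := exists_projection_of_mulVec_eq_zero hB hw _ hj
    exact ⟨π, hπ, fun X => by simp [Fin.sum_univ_succAbove _ j, h0]⟩
  · obtain ⟨π, h0, hπ⟩ := exists_projection_of_mulVec_eq_zero hB hw _ hj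
    exact ⟨π, hπ, fun X => by simp [Fin.sum_univ_succAbove _ j, h0]⟩

/-- If `A` is symmetric of rank `2t` and deleting its first row and column gives `B` of rank
`2t − 2`, then `A` is hyperbolic iff `B` is hyperbolic, and `A` is elliptic iff `B` is
elliptic. -/
theorem border_corank_two (F : Type*) [Field F] [Fintype F] (hq : Odd (Fintype.card F))
    (m t : ℕ) (ht : 1 ≤ t)
    (A : Matrix (Fin (m + 1)) (Fin (m + 1)) F) (hA : A.IsSymm) (hrA : A.rank = 2 * t)
    (B : Matrix (Fin m) (Fin m) F) (hB : B = A.submatrix Fin.succ Fin.succ)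
    (hrB : B.rank = 2 * (t - 1)) :
    (IsHyp A t ↔ IsHyp B (t - 1)) ∧ (IsEll A t ↔ IsEll B (t - 1)) := by
  obtain ⟨s, rfl⟩ : ∃ s, t = s + 1 := ⟨t - 1, by omega⟩
  rw [Nat.add_sub_cancel] at hrB ⊢
  have h2 := two_ne_zero_of_odd_card hq
  have hBs : B.IsSymm := hB ▸ hA.submatrix Fin.succ
  have hm : 2 * (s + 1) ≤ m + 1 := hrA ▸ A.rank_le_width
  obtain ⟨w, hBw, hAw⟩ := exists_mulVec_eq_zero_of_rank_border hrA hrB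
  let ι : (Fin m → F) →ₗ[F] (Fin (m + 1) → F) := LinearMap.pi (Fin.cons 0 LinearMap.proj)
  have hι : ∀ y, ι y = Fin.cons 0 y := fun y => by
    ext i
    cases i using Fin.cases <;> simp [ι]
  have hAι : ∀ y, ι y ⬝ᵥ A *ᵥ ι y = y ⬝ᵥ B *ᵥ y := fun y => by
    rw [hι, quadForm_cons hA, hB]
    simp
  let τ : (Fin (m + 1) → F) →ₗ[F] (Fin m → F) := LinearMap.funLeft F F Fin.succ
  let x₀ : (Fin (m + 1) → F) →ₗ[F] F := LinearMap.proj 0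
  obtain ⟨ℓ, hℓ⟩ : ∃ ℓ : (Fin (m + 1) → F) →ₗ[F] F,
      ∀ X, X ⬝ᵥ A *ᵥ X = x₀ X * ℓ X + τ X ⬝ᵥ B *ᵥ τ X := by
    refine ⟨A 0 0 • x₀ + (2 : F) • ∑ j : Fin m, A 0 j.succ • LinearMap.proj j.succ, fun X => ?_⟩
    have h := quadForm_cons hA (X 0) (Fin.tail X)
    rw [Fin.cons_self_tail, ← hB] at h
    rw [h]
    have hτ : τ X = Fin.tail X := rfl
    simp [x₀, hτ, Fin.tail]
  have hQw : ι w ⬝ᵥ A *ᵥ ι w = 0 := by rw [hAι, hBw, dotProduct_zero]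
  rw [← hι] at hAw
  refine ⟨?_, ?_⟩
  · rw [isHyp_iff_exists_functionals h2 hA hrA, isHyp_iff_exists_functionals h2 hBs hrB]
    constructor
    · rintro ⟨k, hk, p, q, h⟩
      obtain ⟨j, hj⟩ : ∃ j, p j (ι w) ≠ 0 ∨ q j (ι w) ≠ 0 := by
        by_contra! hc
        exact hAw (mulVec_eq_zero_of_quadForm_add_eq h2 hA fun Y => by simp [h, hc])
      obtain ⟨π, hπ, hsum⟩ := exists_projection_sum_succAbove hBs hBw
        (fun i => p i ∘ₗ ι) (fun i => q i ∘ₗ ι) hj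
      refine ⟨k, hk, fun i => p (j.succAbove i) ∘ₗ ι ∘ₗ π,
        fun i => q (j.succAbove i) ∘ₗ ι ∘ₗ π, fun X => ?_⟩
      rw [← hπ, ← hAι, h]
      exact congrArg (k * ·) (hsum X)
    · rintro ⟨k, hk, p, q, h⟩
      refine ⟨k, hk, Fin.cons (k⁻¹ • x₀) fun i => p i ∘ₗ τ, Fin.cons ℓ fun i => q i ∘ₗ τ,
        fun X => ?_⟩
      rw [hℓ, h, Fin.sum_univ_succ]
      simp [mul_add, ← mul_assoc, hk]
  · constructor
    · intro hE
      obtain ⟨k, a, b, c, hk, hd, u, v, p, q, h⟩ := (isEll_iff_exists_functionals h2 hA hrA).1 hE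
      obtain ⟨j, hj⟩ : ∃ j, p j (ι w) ≠ 0 ∨ q j (ι w) ≠ 0 := by
        by_contra! hc
        have h0 := h (ι w)
        simp only [hQw, hc, mul_zero, Finset.sum_const_zero, add_zero] at h0
        obtain ⟨hu, hv⟩ := eq_zero_of_binary_form_eq_zero hd
          ((mul_eq_zero.1 h0.symm).resolve_left hk)
        exact hAw (mulVec_eq_zero_of_quadForm_add_eq h2 hA fun Y => by simp [h, hc, hu, hv])
      obtain ⟨s, rfl⟩ : ∃ s', s = s' + 1 := ⟨s - 1, by have := j.pos; omega⟩
      obtain ⟨π, hπ, hsum⟩ := exists_projection_sum_succAbove hBs hBw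
        (fun i => p i ∘ₗ ι) (fun i => q i ∘ₗ ι) hj
      refine (isEll_iff_exists_functionals h2 hBs hrB).2 ⟨k, a, b, c, hk, hd,
        u ∘ₗ ι ∘ₗ π, v ∘ₗ ι ∘ₗ π, fun i => p (j.succAbove i) ∘ₗ ι ∘ₗ π,
        fun i => q (j.succAbove i) ∘ₗ ι ∘ₗ π, fun X => ?_⟩
      rw [← hπ, ← hAι, h]
      exact congrArg (fun S => k * (_ + S)) (hsum X)
    · intro hE
      obtain _ | s := s
      · exact absurd hE (not_isEll_zero (by omega) hrB)
      obtain ⟨k, a, b, c, hk, hd, u, v, p, q, h⟩ := (isEll_iff_exists_functionals h2 hBs hrB).1 hE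
      refine (isEll_iff_exists_functionals h2 hA hrA).2 ⟨k, a, b, c, hk, hd, u ∘ₗ τ, v ∘ₗ τ,
        Fin.cons (k⁻¹ • x₀) fun i => p i ∘ₗ τ, Fin.cons ℓ fun i => q i ∘ₗ τ, fun X => ?_⟩
      rw [hℓ, h, Fin.sum_univ_succ]
      simp only [Fin.cons_zero, Fin.cons_succ, LinearMap.comp_apply, LinearMap.smul_apply,
        smul_eq_mul]
      field_simp
      ring
end

section
/- Let q be odd and B a symmetric (m−1)×(m−1) matrix over F_q of rank 2t−1. Among the symmetric m×m matrices A = [[0, uB],[Buᵀ, B]] of rank 2t (i.e., with uBuᵀ ≠ 0), exactly ((q−1)/2)·q^{t−1}(q^{t−1}+1) are hyperbolic and exactly ((q−1)/2)·q^{t−1}(q^{t−1}−1) are elliptic. -/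
open Matrix

/-- The sum of `s` hyperbolic planes. -/
def hypForm {F : Type*} [Field F] {s : ℕ} (z : Fin s → F × F) : F := ∑ i, (z i).1 * (z i).2

theorem hypForm_cons {F : Type*} [Field F] {s : ℕ} (p : F × F) (z : Fin s → F × F) :
    hypForm (Fin.cons p z : Fin (s + 1) → F × F) = p.1 * p.2 + hypForm z := by
  simp [hypForm, Fin.sum_univ_succ]

theorem card_mul_eq_add {F : Type*} [Field F] [Fintype F] [DecidableEq F] (c : F) :
    (Nat.card {p : F × F // c + p.1 * p.2 = 0} : ℤ) =
      Nat.card F - 1 + (if c = 0 then (Nat.card F : ℤ) else 0) := by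
  have key : ∀ x : F, (Fintype.card {y : F // c + x * y = 0} : ℤ) =
      if x = 0 then (if c = 0 then (Fintype.card F : ℤ) else 0) else 1 := by
    intro x
    by_cases hx : x = 0
    · by_cases hc : c = 0 <;> simp [hx, hc]
    · have : Unique {y : F // c + x * y = 0} :=
        { default := ⟨-c / x, by field_simp; ring⟩
          uniq := fun y => Subtype.ext (by have := y.2; field_simp; linear_combination this) }
      simp [hx]
  have e : {p : F × F // c + p.1 * p.2 = 0} ≃ Σ x : F, {y : F // c + x * y = 0} :=
    { toFun := fun p => ⟨p.1.1, p.1.2, p.2⟩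
      invFun := fun p => ⟨(p.1, p.2.1), p.2.2⟩
      left_inv := fun _ => rfl
      right_inv := fun _ => rfl }
  rw [Nat.card_congr e, Nat.card_eq_fintype_card, Nat.card_eq_fintype_card, Fintype.card_sigma]
  push_cast
  simp_rw [key]
  rw [← Finset.add_sum_erase _ _ (Finset.mem_univ (0 : F)), if_pos rfl,
    Finset.sum_congr rfl (fun x hx => if_neg (Finset.ne_of_mem_erase hx))]
  have : 1 ≤ Fintype.card F := Fintype.card_pos
  simp [Finset.card_erase_of_mem, Nat.cast_sub this, Finset.card_univ]
  ring

/-- Zeros of a function plus a sum of hyperbolic planes, in terms of zeros of the function. -/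
theorem card_add_hypForm.{u} {F : Type u} [Field F] [Fintype F] (s : ℕ) :
    ∀ {P : Type u} [Finite P] (g : P → F),
    (Nat.card F : ℤ) * Nat.card {x : P × (Fin s → F × F) // g x.1 + hypForm x.2 = 0} =
      Nat.card P * ((Nat.card F : ℤ) ^ (2 * s) - (Nat.card F : ℤ) ^ s) +
        (Nat.card F : ℤ) ^ (s + 1) * Nat.card {p : P // g p = 0} := by
  classical
  induction s with
  | zero =>
    intro P _ g
    have e : {x : P × (Fin 0 → F × F) // g x.1 + hypForm x.2 = 0} ≃ {p : P // g p = 0} :=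
      (Equiv.prodUnique P (Fin 0 → F × F)).subtypeEquiv (fun x => by simp [hypForm])
    rw [Nat.card_congr e]
    simp
  | succ s ih =>
    intro P _ g
    have := Fintype.ofFinite P
    have e : {x : (P × F × F) × (Fin s → F × F) //
        (g x.1.1 + x.1.2.1 * x.1.2.2) + hypForm x.2 = 0} ≃
        {x : P × (Fin (s + 1) → F × F) // g x.1 + hypForm x.2 = 0} :=
      ((Equiv.prodAssoc P (F × F) (Fin s → F × F)).trans
        ((Equiv.refl P).prodCongr (Fin.consEquiv fun _ => F × F))).subtypeEquiv (fun x => by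
          change _ ↔ g x.1.1 + hypForm (Fin.cons x.1.2 x.2 : Fin (s + 1) → F × F) = 0
          rw [hypForm_cons, add_assoc])
    have h2 : (Nat.card {x : P × F × F // g x.1 + x.2.1 * x.2.2 = 0} : ℤ) =
        Nat.card P * (Nat.card F - 1) + Nat.card F * Nat.card {p : P // g p = 0} := by
      have e : {x : P × F × F // g x.1 + x.2.1 * x.2.2 = 0} ≃
          Σ p : P, {y : F × F // g p + y.1 * y.2 = 0} :=
        { toFun := fun p => ⟨p.1.1, p.1.2, p.2⟩
          invFun := fun p => ⟨(p.1, p.2.1), p.2.2⟩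
          left_inv := fun _ => rfl
          right_inv := fun _ => rfl }
      rw [Nat.card_congr e, Nat.card_sigma]
      push_cast
      simp_rw [card_mul_eq_add]
      rw [Finset.sum_add_distrib, ← Finset.sum_filter, Finset.sum_const, Finset.sum_const,
        Nat.card_eq_fintype_card (α := P), Nat.card_eq_fintype_card (α := {p : P // g p = 0}),
        Fintype.card_subtype, Finset.card_univ]
      simp only [nsmul_eq_mul]
      ring
    rw [← Nat.card_congr e, ih (fun p : P × F × F => g p.1 + p.2.1 * p.2.2), h2, Nat.card_prod,
      Nat.card_prod]
    push_cast
    ring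

section OddCharacteristic

variable {F : Type*} [Field F]

/-- A bijection between the coordinates of two ternary forms. -/
def ternaryEquiv (h2 : (2 : F) ≠ 0) (a b c α β : F) (hc : c ≠ 0)
    (h : a * α ^ 2 + b * β ^ 2 = -c) : (F × F × F) ≃ₗ[F] F × F × F where
  toFun v := ((α * v.2.1 - β * v.1) / -c,
    c * (v.2.2 - (a * α * v.1 + b * β * v.2.1) / -c), v.2.2 + (a * α * v.1 + b * β * v.2.1) / -c)
  invFun w := (α * ((w.2.2 - w.2.1 / c) / 2) - b * β * w.1,
    β * ((w.2.2 - w.2.1 / c) / 2) + a * α * w.1, (w.2.2 + w.2.1 / c) / 2)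
  map_add' v w := by
    ext <;> simp <;> ring
  map_smul' k v := by
    ext <;> simp <;> ring
  left_inv v := by
    ext <;> simp <;> field_simp
    · linear_combination (-2 * v.1) * h
    · linear_combination (-2 * v.2.1) * h
    · ring
  right_inv w := by
    ext <;> simp <;> field_simp
    · linear_combination (-2 * c * w.1) * h
    · linear_combination (c * w.2.2 - w.2.1) * h
    · linear_combination (w.2.1 - c * w.2.2) * h

theorem ternaryEquiv_form (h2 : (2 : F) ≠ 0) (a b c α β : F) (hc : c ≠ 0)
    (h : a * α ^ 2 + b * β ^ 2 = -c) (v : F × F × F) :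
    a * v.1 ^ 2 + b * v.2.1 ^ 2 + c * v.2.2 ^ 2 =
      -a * b * c * (ternaryEquiv h2 a b c α β hc h v).1 ^ 2 +
        (ternaryEquiv h2 a b c α β hc h v).2.1 * (ternaryEquiv h2 a b c α β hc h v).2.2 := by
  simp only [ternaryEquiv, LinearEquiv.coe_mk, LinearMap.coe_mk, AddHom.coe_mk]
  field_simp
  linear_combination (a * v.1 ^ 2 + b * v.2.1 ^ 2) * h

theorem exists_quadratic_eq [Fintype F] (hq : Odd (Fintype.card F)) {a b : F} (ha : a ≠ 0)
    (hb : b ≠ 0) (c : F) : ∃ α β : F, a * α ^ 2 + b * β ^ 2 = c := by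
  open Polynomial in
  obtain ⟨α, β, h⟩ := FiniteField.exists_root_sum_quadratic
    (f := C a * X ^ 2 - C c) (g := C b * X ^ 2) 
    (by rw [degree_sub_C] <;> rw [degree_C_mul_X_pow 2 ha] <;> decide)
    (degree_C_mul_X_pow 2 hb) (Nat.odd_iff.1 hq)
  exact ⟨α, β, by simp at h; linear_combination h⟩

theorem exists_odd_diagonal_normal_form [Fintype F] (hq : Odd (Fintype.card F))
    (h2 : (2 : F) ≠ 0) (s : ℕ) : ∀ a : Fin (2 * s + 1) → F, (∀ i, a i ≠ 0) →
    ∃ (e : (Fin (2 * s + 1) → F) ≃ₗ[F] F × (Fin s → F × F)) (b : F), b ≠ 0 ∧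
      ∀ x, ∑ i, a i * x i ^ 2 = b * (e x).1 ^ 2 + hypForm (e x).2 := by
  induction s with
  | zero =>
    intro a ha
    refine ⟨(LinearEquiv.funUnique (Fin 1) F F).trans (LinearEquiv.prodUnique).symm, a 0, ha 0, ?_⟩
    intro x
    simp [hypForm]
  | succ s ih =>
    intro a ha
    obtain ⟨e, b, hb, he⟩ := ih (fun i => a i.succ.succ) (fun i => ha _)
    obtain ⟨α, β, h⟩ := exists_quadratic_eq hq (ha 0) (ha 1) (-b)
    let T := ternaryEquiv h2 (a 0) (a 1) b α β hb h
    let E : (Fin (2 * (s + 1) + 1) → F) ≃ₗ[F] F × F × F × (Fin s → F × F) :=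
      (Fin.consLinearEquiv F fun _ : Fin (2 * s + 2 + 1) => F).symm.trans
        ((LinearEquiv.refl F F).prodCongr
          ((Fin.consLinearEquiv F fun _ : Fin (2 * s + 1 + 1) => F).symm.trans
            ((LinearEquiv.refl F F).prodCongr e)))
    let G : (F × F × F × (Fin s → F × F)) ≃ₗ[F] F × (Fin (s + 1) → F × F) :=
      { toFun := fun v => ((T (v.1, v.2.1, v.2.2.1)).1, Fin.cons (T (v.1, v.2.1, v.2.2.1)).2 v.2.2.2)
        invFun := fun w => ((T.symm (w.1, w.2 0)).1, (T.symm (w.1, w.2 0)).2.1,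
          (T.symm (w.1, w.2 0)).2.2, Fin.tail w.2)
        map_add' := fun v w => by
          have : T ((v + w).1, (v + w).2.1, (v + w).2.2.1) =
            T (v.1, v.2.1, v.2.2.1) + T (w.1, w.2.1, w.2.2.1) := by rw [← map_add]; rfl
          simp only [this]
          refine Prod.ext rfl (funext fun i => ?_)
          refine Fin.cases ?_ (fun i => ?_) i <;> simp
        map_smul' := fun k w => by
          have : T ((k • w).1, (k • w).2.1, (k • w).2.2.1) =
            k • T (w.1, w.2.1, w.2.2.1) := by rw [← map_smul]; rfl
          simp only [this]
          refine Prod.ext rfl (funext fun i => ?_)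
          refine Fin.cases ?_ (fun i => ?_) i <;> simp
        left_inv := fun v => by simp
        right_inv := fun v => by simp }
    refine ⟨E.trans G, -a 0 * a 1 * b, by simp [ha, hb], fun x => ?_⟩
    have hE : E x = (x 0, x 1, e (fun i => x i.succ.succ)) := rfl
    simp only [LinearEquiv.trans_apply, hE]
    have hG : ∀ v, G v = ((T (v.1, v.2.1, v.2.2.1)).1,
      Fin.cons (T (v.1, v.2.1, v.2.2.1)).2 v.2.2.2) := fun v => rfl
    rw [hG, hypForm_cons]
    have hs : ∑ i, a i * x i ^ 2 = a 0 * x 0 ^ 2 + (a 1 * x 1 ^ 2 +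
        ∑ i : Fin (2 * s + 1), a i.succ.succ * x i.succ.succ ^ 2) :=
      (Fin.sum_univ_succ (n := 2 * s + 2) _).trans
        (congrArg (_ + ·) (Fin.sum_univ_succ (n := 2 * s + 1) _))
    rw [hs, he, ← add_assoc, ← add_assoc, ← add_assoc]
    exact congrArg (· + _) (ternaryEquiv_form h2 (a 0) (a 1) b α β hb h
      (x 0, x 1, (e fun i => x i.succ.succ).1))

theorem two_mul_dotProduct_mulVec {n : ℕ} {B : Matrix (Fin n) (Fin n) F} (hB : B.IsSymm)
    (x y : Fin n → F) :
    2 * (x ⬝ᵥ B *ᵥ y) = (x + y) ⬝ᵥ B *ᵥ (x + y) - x ⬝ᵥ B *ᵥ x - y ⬝ᵥ B *ᵥ y := by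
  have : y ⬝ᵥ B *ᵥ x = x ⬝ᵥ B *ᵥ y := by
    rw [dotProduct_mulVec, dotProduct_comm, ← mulVec_transpose, hB.eq]
  simp only [mulVec_add, add_dotProduct, dotProduct_add, this]
  ring

theorem mulVec_eq_zero_iff_forall_add {n : ℕ} (h2 : (2 : F) ≠ 0) {B : Matrix (Fin n) (Fin n) F}
    (hB : B.IsSymm) (d : Fin n → F) :
    B *ᵥ d = 0 ↔ ∀ x, (x + d) ⬝ᵥ B *ᵥ (x + d) = x ⬝ᵥ B *ᵥ x := by
  constructor
  · intro h x
    have h1 := two_mul_dotProduct_mulVec hB x d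
    have h2 : d ⬝ᵥ B *ᵥ d = 0 := by simp [h]
    rw [h2] at h1
    simp only [h, dotProduct_zero] at h1
    linear_combination -h1
  · intro h
    have hd : d ⬝ᵥ B *ᵥ d = 0 := by simpa using h 0
    refine dotProduct_eq_zero _ fun x => ?_
    rw [dotProduct_comm]
    refine (mul_eq_zero.1 ?_).resolve_left h2
    rw [two_mul_dotProduct_mulVec hB x d, h x, hd]
    ring

theorem eq_of_forall_dotProduct_mulVec_eq {n : ℕ} (h2 : (2 : F) ≠ 0)
    {A B : Matrix (Fin n) (Fin n) F} (hA : A.IsSymm) (hB : B.IsSymm)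
    (h : ∀ x, x ⬝ᵥ A *ᵥ x = x ⬝ᵥ B *ᵥ x) : A = B := by
  rw [← sub_eq_zero]
  refine Matrix.ext_of_mulVec_single fun i => ?_
  rw [zero_mulVec, mulVec_eq_zero_iff_forall_add h2 (hA.sub hB)]
  simp [sub_mulVec, h]

theorem rank_eq_of_linearEquiv {n : ℕ} (h2 : (2 : F) ≠ 0) {A B : Matrix (Fin n) (Fin n) F}
    (hA : A.IsSymm) (hB : B.IsSymm) (e : (Fin n → F) ≃ₗ[F] (Fin n → F))
    (h : ∀ x, x ⬝ᵥ A *ᵥ x = e x ⬝ᵥ B *ᵥ e x) : A.rank = B.rank := by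
  set L := LinearMap.toMatrix' (e : (Fin n → F) →ₗ[F] (Fin n → F)) with hL
  have hLe : ∀ x, L *ᵥ x = e x := fun x => by
    rw [hL, LinearMap.toMatrix'_mulVec]; rfl
  have hdet : IsUnit L.det := by
    rw [hL, LinearMap.det_toMatrix']; exact LinearEquiv.isUnit_det' e
  have hAB : A = Lᵀ * B * L := by
    refine eq_of_forall_dotProduct_mulVec_eq h2 hA ?_ fun x => ?_
    · simp [IsSymm, transpose_mul, hB.eq, Matrix.mul_assoc]
    · rw [h, ← hLe, ← mulVec_mulVec, ← mulVec_mulVec, dotProduct_mulVec _ Lᵀ, vecMul_transpose]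
  rw [hAB, rank_mul_eq_left_of_isUnit_det _ _ hdet,
    rank_mul_eq_right_of_isUnit_det _ _ (by rwa [det_transpose])]

/-- A quadratic form of odd rank over a finite field of odd order is parabolic. -/
theorem exists_parabolic_normal_form [Fintype F] (hq : Odd (Fintype.card F)) (h2 : (2 : F) ≠ 0)
    {n s : ℕ} {B : Matrix (Fin n) (Fin n) F} (hB : B.IsSymm) (hr : B.rank = 2 * s + 1) :
    ∃ (m : ℕ) (e : (Fin n → F) ≃ₗ[F] F × (Fin s → F × F) × (Fin m → F)) (b : F),
      n = 2 * s + 1 + m ∧ b ≠ 0 ∧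
      ∀ x, x ⬝ᵥ B *ᵥ x = b * (e x).1 ^ 2 + hypForm (e x).2.1 := by
  classical
  have : Invertible (2 : F) := invertibleOfNonzero h2
  obtain ⟨w, ⟨E⟩⟩ : ∃ w : Fin n → F, QuadraticMap.Equivalent B.toQuadraticForm'
      (QuadraticMap.weightedSumSquares F w) := by
    have h := QuadraticForm.equivalent_weightedSumSquares B.toQuadraticForm'
    rwa [Module.finrank_fin_fun] at h
  have hE : ∀ x, x ⬝ᵥ B *ᵥ x = ∑ i, w i * E x i ^ 2 := fun x => by
    have h := E.map_app x
    simp only [QuadraticMap.weightedSumSquares_apply, toQuadraticForm',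
      LinearMap.BilinMap.toQuadraticMap_apply, toLinearMap₂'_apply'] at h
    rw [← h]
    exact Finset.sum_congr rfl fun i _ => by rw [smul_eq_mul, sq]; rfl
  have hcard : Fintype.card {i // w i ≠ 0} = 2 * s + 1 := by
    rw [← rank_diagonal, ← hr]
    refine (rank_eq_of_linearEquiv h2 hB (isSymm_diagonal w) E.toLinearEquiv fun x => ?_).symm
    rw [hE]
    exact Finset.sum_congr rfl fun i _ => by
      rw [mulVec_diagonal]
      change _ * E x i ^ 2 = E x i * (_ * E x i)
      ring
  let m := Fintype.card {i // ¬ w i ≠ 0}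
  let σ : Fin (2 * s + 1) ⊕ Fin m ≃ Fin n :=
    ((Fintype.equivFinOfCardEq hcard).symm.sumCongr (Fintype.equivFin _).symm).trans
      (Equiv.sumCompl _)
  have hσ₁ : ∀ i, w (σ (Sum.inl i)) ≠ 0 := fun i =>
    ((Fintype.equivFinOfCardEq hcard).symm i).2
  have hσ₂ : ∀ i, w (σ (Sum.inr i)) = 0 := fun i =>
    not_not.1 ((Fintype.equivFin {i // ¬ w i ≠ 0}).symm i).2
  obtain ⟨e, b, hb, he⟩ := exists_odd_diagonal_normal_form hq h2 s _ hσ₁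
  refine ⟨m, E.toLinearEquiv.trans ((LinearEquiv.funCongrLeft F F σ).trans
    ((LinearEquiv.sumArrowLequivProdArrow _ _ F F).trans
      ((e.prodCongr (LinearEquiv.refl F (Fin m → F))).trans (LinearEquiv.prodAssoc F _ _ _)))),
    b, ?_, hb, fun x => ?_⟩
  · simpa using (Fintype.card_congr σ).symm
  · rw [hE, ← Equiv.sum_comp σ, Fintype.sum_sum_type]
    simp only [hσ₂, zero_mul, Finset.sum_const_zero, add_zero]
    exact he fun i => E x (σ (Sum.inl i))

/-- The matrix bordering `B` by zero, `u B` and its transpose. -/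
def border {n : ℕ} (B : Matrix (Fin n) (Fin n) F) (u : Fin n → F) :
    Matrix (Fin (n + 1)) (Fin (n + 1)) F :=
  Matrix.of (Fin.cons (Fin.cons 0 (u ᵥ* B)) fun i => Fin.cons ((B *ᵥ u) i) (B i))

theorem border_mulVec_cons {n : ℕ} (B : Matrix (Fin n) (Fin n) F) (u : Fin n → F) (a : F)
    (x : Fin n → F) :
    border B u *ᵥ (Fin.cons a x : Fin (n + 1) → F) =
      (Fin.cons (u ⬝ᵥ B *ᵥ x) (B *ᵥ (x + a • u)) : Fin (n + 1) → F) := by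
  funext i
  refine Fin.cases ?_ (fun i => ?_) i
  · simp [border, mulVec, dotProduct, Fin.sum_univ_succ]
    exact (dotProduct_mulVec u B x).symm
  · simp only [mulVec_add, mulVec_smul, Fin.cons_succ, Pi.add_apply, Pi.smul_apply]
    simp [border, mulVec, dotProduct, Fin.sum_univ_succ]
    ring

theorem border_form {n : ℕ} (B : Matrix (Fin n) (Fin n) F) (u : Fin n → F)
    (X : Fin (n + 1) → F) :
    X ⬝ᵥ border B u *ᵥ X = (Fin.tail X + X 0 • u) ⬝ᵥ B *ᵥ (Fin.tail X + X 0 • u) -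
      X 0 ^ 2 * (u ⬝ᵥ B *ᵥ u) := by
  have h : X ⬝ᵥ border B u *ᵥ X = X 0 * (u ⬝ᵥ B *ᵥ Fin.tail X) +
      Fin.tail X ⬝ᵥ B *ᵥ (Fin.tail X + X 0 • u) := by
    conv_lhs => rw [← Fin.cons_self_tail X, border_mulVec_cons]
    simp [dotProduct, Fin.sum_univ_succ]
    rfl
  rw [h]
  simp only [mulVec_add, mulVec_smul, add_dotProduct, dotProduct_add, smul_dotProduct,
    dotProduct_smul, smul_eq_mul]
  ring

theorem rank_border {n : ℕ} {B : Matrix (Fin n) (Fin n) F} {u : Fin n → F}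
    (hu : u ⬝ᵥ B *ᵥ u ≠ 0) : (border B u).rank = B.rank + 1 := by
  have hmem : ∀ (a : F) (x : Fin n → F),
      border B u *ᵥ (Fin.cons a x : Fin (n + 1) → F) = 0 ↔ a = 0 ∧ B *ᵥ x = 0 := by
    intro a x
    rw [border_mulVec_cons]
    constructor
    · intro h
      have h0 : u ⬝ᵥ B *ᵥ x = 0 := by simpa using congrFun h 0
      have h1 : B *ᵥ (x + a • u) = 0 := funext fun i => by simpa using congrFun h i.succ
      have ha : a = 0 := by
        have := congrArg (u ⬝ᵥ ·) h1
        simp only [mulVec_add, mulVec_smul, dotProduct_add, dotProduct_smul, h0, zero_add,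
          smul_eq_mul, dotProduct_zero] at this
        exact (mul_eq_zero.1 this).resolve_right hu
      exact ⟨ha, by simpa [ha] using h1⟩
    · rintro ⟨rfl, h⟩
      funext i
      refine Fin.cases ?_ (fun i => ?_) i <;> simp [h]
  let K : LinearMap.ker B.mulVecLin ≃ₗ[F] LinearMap.ker (border B u).mulVecLin :=
    { toFun := fun x => ⟨(Fin.cons 0 x.1 : Fin (n + 1) → F), by
        have := x.2
        simp only [LinearMap.mem_ker, mulVecLin_apply] at this ⊢
        exact (hmem _ _).2 ⟨rfl, this⟩⟩
      map_add' := fun x y => Subtype.ext (funext fun i => by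
        refine Fin.cases ?_ (fun i => ?_) i <;> simp)
      map_smul' := fun x y => Subtype.ext (funext fun i => by
        refine Fin.cases ?_ (fun i => ?_) i <;> simp)
      invFun := fun x => ⟨Fin.tail x.1, by
        have := x.2
        simp only [LinearMap.mem_ker, mulVecLin_apply] at this ⊢
        rw [← Fin.cons_self_tail x.1] at this
        exact ((hmem _ _).1 this).2⟩
      left_inv := fun x => by simp
      right_inv := fun x => Subtype.ext (by
        have := x.2
        simp only [LinearMap.mem_ker, mulVecLin_apply] at this
        rw [← Fin.cons_self_tail x.1] at this
        conv_rhs => rw [← Fin.cons_self_tail x.1, ((hmem _ _).1 this).1]) }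
  have h1 := LinearMap.finrank_range_add_finrank_ker B.mulVecLin
  have h3 := LinearMap.finrank_range_add_finrank_ker (border B u).mulVecLin
  rw [← K.finrank_eq] at h3
  simp only [Module.finrank_fin_fun] at h1 h3
  simp only [Matrix.rank]
  omega

theorem border_isSymm {n : ℕ} {B : Matrix (Fin n) (Fin n) F} (hB : B.IsSymm) (u : Fin n → F) :
    (border B u).IsSymm := by
  have : u ᵥ* B = B *ᵥ u := by rw [← mulVec_transpose, hB.eq]
  refine Matrix.IsSymm.ext fun i j => ?_
  refine Fin.cases ?_ (fun i => ?_) i <;> refine Fin.cases ?_ (fun j => ?_) j <;>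
    simp [border, this, hB.apply]
theorem hypForm_add {s : ℕ} (z d : Fin s → F × F) :
    hypForm (z + d) = hypForm z + hypForm d + ∑ i, ((z i).1 * (d i).2 + (d i).1 * (z i).2) := by
  simp only [hypForm, ← Finset.sum_add_distrib, Pi.add_apply, Prod.fst_add, Prod.snd_add]
  exact Finset.sum_congr rfl fun i _ => by ring

theorem parabolic_radical {s : ℕ} (h2 : (2 : F) ≠ 0) {b : F} (hb : b ≠ 0)
    (d : F × (Fin s → F × F)) :
    (∀ x : F × (Fin s → F × F),
      b * (x + d).1 ^ 2 + hypForm (x + d).2 = b * x.1 ^ 2 + hypForm x.2) ↔ d = 0 := by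
  classical
  constructor
  · intro h
    have h0 := h 0
    have hz : hypForm (0 : Fin s → F × F) = 0 := by simp [hypForm]
    have hd1 : d.1 = 0 := by
      have h1 := h (1, 0)
      simp only [zero_add, Prod.fst_zero, Prod.snd_zero, Prod.fst_add, Prod.snd_add, hz] at h0 h1
      have : 2 * b * d.1 = 0 := by linear_combination h1 - h0
      simpa [h2, hb] using this
    have hd2 : ∀ i, d.2 i = 0 := fun i => by
      have key : ∀ p : F × F, p.1 * (d.2 i).2 + (d.2 i).1 * p.2 = 0 := fun p => by
        have h1 := h (0, Pi.single i p)
        have h3 : ∑ j, (((Pi.single i p : Fin s → F × F) j).1 * (d.2 j).2 +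
            (d.2 j).1 * ((Pi.single i p : Fin s → F × F) j).2) =
            p.1 * (d.2 i).2 + (d.2 i).1 * p.2 := by
          rw [Finset.sum_eq_single i]
          · simp
          · intro j _ hj
            simp [hj]
          · simp
        simp only [zero_add, Prod.fst_zero, Prod.snd_zero, Prod.fst_add, Prod.snd_add, hz,
          hypForm_add, h3] at h0 h1
        linear_combination h1 - h0
      exact Prod.ext (by simpa using key (0, 1)) (by simpa using key (1, 0))
    exact Prod.ext hd1 (funext hd2)
  · rintro rfl x
    simp

/-- The indices of the standard forms, grouped into the leading pair, the hyperbolic pairs and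
the remaining indices. -/
def stdIndexEquiv (s m : ℕ) : Fin 2 ⊕ (Fin s × Fin 2) ⊕ Fin m ≃ Fin (2 + (s * 2 + m)) :=
  ((Equiv.refl _).sumCongr ((finProdFinEquiv.sumCongr (Equiv.refl _)).trans finSumFinEquiv)).trans
    finSumFinEquiv

theorem stdIndexEquiv_inl (s m : ℕ) (i : Fin 2) : (stdIndexEquiv s m (Sum.inl i)).val = i.val := by
  simp [stdIndexEquiv]

theorem stdIndexEquiv_inr_inl (s m : ℕ) (i : Fin s) (j : Fin 2) :
    (stdIndexEquiv s m (Sum.inr (Sum.inl (i, j)))).val = 2 + (j.val + 2 * i.val) := by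
  simp [stdIndexEquiv]

theorem stdIndexEquiv_inr_inr (s m : ℕ) (k : Fin m) :
    (stdIndexEquiv s m (Sum.inr (Sum.inr k))).val = 2 + (s * 2 + k.val) := by
  simp [stdIndexEquiv]

variable (F) in
/-- Coordinates adapted to the standard forms. -/
def stdCoordEquiv (s m : ℕ) :
    (Fin (2 + (s * 2 + m)) → F) ≃ₗ[F] (F × F) × (Fin s → F × F) × (Fin m → F) where
  toFun X := ((X (stdIndexEquiv s m (Sum.inl 0)), X (stdIndexEquiv s m (Sum.inl 1))),
    fun i => (X (stdIndexEquiv s m (Sum.inr (Sum.inl (i, 0)))),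
      X (stdIndexEquiv s m (Sum.inr (Sum.inl (i, 1))))),
    fun k => X (stdIndexEquiv s m (Sum.inr (Sum.inr k))))
  map_add' _ _ := rfl
  map_smul' _ _ := rfl
  invFun w i := Sum.elim ![w.1.1, w.1.2]
    (Sum.elim (fun p => ![(w.2.1 p.1).1, (w.2.1 p.1).2] p.2) w.2.2) ((stdIndexEquiv s m).symm i)
  left_inv X := by
    funext i
    obtain ⟨j, rfl⟩ := (stdIndexEquiv s m).surjective i
    beta_reduce
    rw [Equiv.symm_apply_apply]
    rcases j with j | ⟨i, j⟩ | k
    · fin_cases j <;> rfl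
    · fin_cases j <;> rfl
    · rfl
  right_inv w := by
    simp

theorem stdEll_form (s m : ℕ) (a b c : F) (X : Fin (2 + (s * 2 + m)) → F) :
    X ⬝ᵥ stdEll F _ (s + 1) a b c *ᵥ X =
      a * (stdCoordEquiv F s m X).1.1 ^ 2 +
        b * (stdCoordEquiv F s m X).1.1 * (stdCoordEquiv F s m X).1.2 +
        c * (stdCoordEquiv F s m X).1.2 ^ 2 + hypForm (stdCoordEquiv F s m X).2.1 := by
  set M := stdEll F (2 + (s * 2 + m)) (s + 1) a b c with hM
  set φ := stdIndexEquiv s m with hφ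
  have val_lead : ∀ i, (φ (Sum.inl i)).val = i.val := stdIndexEquiv_inl s m
  have val_pair : ∀ i j, (φ (Sum.inr (Sum.inl (i, j)))).val = 2 + (j.val + 2 * i.val) :=
    stdIndexEquiv_inr_inl s m
  have val_rest : ∀ k, (φ (Sum.inr (Sum.inr k))).val = 2 + (s * 2 + k.val) :=
    stdIndexEquiv_inr_inr s m
  have lead₀₀ : M (φ (Sum.inl 0)) (φ (Sum.inl 0)) = a := by
    simp only [hM, stdEll, of_apply, val_lead, Fin.val_zero]
    simp
  have lead₀₁ : M (φ (Sum.inl 0)) (φ (Sum.inl 1)) = b := by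
    simp only [hM, stdEll, of_apply, val_lead, Fin.val_zero, Fin.val_one]
    simp
  have lead₁₀ : M (φ (Sum.inl 1)) (φ (Sum.inl 0)) = 0 := by
    simp only [hM, stdEll, of_apply, val_lead, Fin.val_zero, Fin.val_one]
    simp
  have lead₁₁ : M (φ (Sum.inl 1)) (φ (Sum.inl 1)) = c := by
    simp only [hM, stdEll, of_apply, val_lead, Fin.val_one]
    simp
  have lead_pair : ∀ i k j, M (φ (Sum.inl i)) (φ (Sum.inr (Sum.inl (k, j)))) = 0 := by
    intro i k j
    simp only [hM, stdEll, of_apply, val_lead, val_pair]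
    split_ifs <;> first | rfl | omega
  have lead_rest : ∀ i k, M (φ (Sum.inl i)) (φ (Sum.inr (Sum.inr k))) = 0 := by
    intro i k
    simp only [hM, stdEll, of_apply, val_lead, val_rest]
    split_ifs <;> first | rfl | omega
  have pair_lead : ∀ i j k, M (φ (Sum.inr (Sum.inl (i, j)))) (φ (Sum.inl k)) = 0 := by
    intro i j k
    simp only [hM, stdEll, of_apply, val_lead, val_pair]
    split_ifs <;> first | rfl | omega
  have pair₀₁ : ∀ i k, M (φ (Sum.inr (Sum.inl (i, 0)))) (φ (Sum.inr (Sum.inl (k, 1)))) =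
      if k = i then 1 else 0 := by
    intro i k
    simp only [hM, stdEll, of_apply, val_pair, Fin.val_zero, Fin.val_one, Fin.ext_iff]
    split_ifs <;> first | rfl | omega
  have pair₀₀ : ∀ i k, M (φ (Sum.inr (Sum.inl (i, 0)))) (φ (Sum.inr (Sum.inl (k, 0)))) = 0 := by
    intro i k
    simp only [hM, stdEll, of_apply, val_pair, Fin.val_zero]
    split_ifs <;> first | rfl | omega
  have pair₁ : ∀ i k j, M (φ (Sum.inr (Sum.inl (i, 1)))) (φ (Sum.inr (Sum.inl (k, j)))) = 0 := by
    intro i k j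
    simp only [hM, stdEll, of_apply, val_pair, Fin.val_one]
    split_ifs <;> first | rfl | omega
  have pair_rest : ∀ i j k, M (φ (Sum.inr (Sum.inl (i, j)))) (φ (Sum.inr (Sum.inr k))) = 0 := by
    intro i j k
    simp only [hM, stdEll, of_apply, val_pair, val_rest]
    split_ifs <;> first | rfl | omega
  have rest : ∀ k i, M (φ (Sum.inr (Sum.inr k))) (φ i) = 0 := by
    intro k i
    rcases i with i | ⟨i, j⟩ | i <;>
      simp only [hM, stdEll, of_apply, val_lead, val_pair, val_rest] <;>
      split_ifs <;> first | rfl | omega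
  simp only [mulVec, dotProduct]
  rw [← Equiv.sum_comp φ]
  simp_rw [← Equiv.sum_comp φ (fun j => M _ j * X j)]
  simp only [Fintype.sum_sum_type, Fintype.sum_prod_type, Fin.sum_univ_two, lead₀₀, lead₀₁,
    lead₁₀, lead₁₁, lead_pair, lead_rest, pair_lead, pair₀₁, pair₀₀, pair₁, pair_rest, rest,
    zero_mul, mul_zero, ite_mul, one_mul, add_zero, zero_add, Finset.sum_const_zero,
    Finset.sum_ite_eq', Finset.mem_univ, if_true, stdCoordEquiv, LinearEquiv.coe_mk,
    LinearMap.coe_mk, AddHom.coe_mk, hypForm, ← hφ]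
  ring

theorem stdHyp_eq_stdEll (N s : ℕ) : stdHyp F N (s + 1) = stdEll F N (s + 1) 0 1 0 := by
  ext i j
  simp only [stdHyp, stdEll, of_apply]
  split_ifs <;> first | rfl | omega

theorem quadEquiv_iff_exists_linearEquiv {n : ℕ} (A M : Matrix (Fin n) (Fin n) F) :
    QuadEquiv A M ↔ ∃ e : (Fin n → F) ≃ₗ[F] (Fin n → F), ∀ x, x ⬝ᵥ A *ᵥ x = e x ⬝ᵥ M *ᵥ e x := by
  constructor
  · rintro ⟨L, hL, h⟩
    exact ⟨L.toLinearEquiv' (L.invertibleOfIsUnitDet hL), h⟩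
  · rintro ⟨e, h⟩
    refine ⟨LinearMap.toMatrix' (e : (Fin n → F) →ₗ[F] (Fin n → F)), ?_, fun x => ?_⟩
    · rw [LinearMap.det_toMatrix']
      exact LinearEquiv.isUnit_det' e
    · rw [LinearMap.toMatrix'_mulVec]
      exact h x

/-- The form of `A` is `k` times a binary form with the given coefficients plus hyperbolic
planes. -/
def HasNormalForm {N : ℕ} (A : Matrix (Fin N) (Fin N) F) (s m : ℕ) (k a b c : F) : Prop :=
  ∃ e : (Fin N → F) ≃ₗ[F] (F × F) × (Fin s → F × F) × (Fin m → F), ∀ x, x ⬝ᵥ A *ᵥ x =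
    k * (a * (e x).1.1 ^ 2 + b * (e x).1.1 * (e x).1.2 + c * (e x).1.2 ^ 2 + hypForm (e x).2.1)

theorem quadEquiv_stdEll_iff {N s m : ℕ} (hN : N = 2 + (s * 2 + m))
    (A : Matrix (Fin N) (Fin N) F) (k a b c : F) :
    QuadEquiv A (k • stdEll F N (s + 1) a b c) ↔ HasNormalForm A s m k a b c := by
  subst hN
  rw [quadEquiv_iff_exists_linearEquiv]
  simp only [smul_mulVec, dotProduct_smul, smul_eq_mul, stdEll_form]
  constructor
  · rintro ⟨e, h⟩
    exact ⟨e.trans (stdCoordEquiv F s m), h⟩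
  · rintro ⟨e, h⟩
    exact ⟨e.trans (stdCoordEquiv F s m).symm, fun x => by simpa using h x⟩
theorem eq_zero_of_binary_eq_zero {a b c : F} (hd : ¬ IsSquare (b ^ 2 - 4 * a * c)) (p : F × F)
    (h : a * p.1 ^ 2 + b * p.1 * p.2 + c * p.2 ^ 2 = 0) : p = 0 := by
  obtain ⟨x, y⟩ := p
  simp only at h
  have hy : y = 0 := by
    by_contra hy
    refine hd ⟨(2 * a * x + b * y) / y, ?_⟩
    field_simp
    linear_combination (-4 * a) * h
  subst hy
  have ha : a ≠ 0 := by
    rintro rfl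
    exact hd ⟨b, by ring⟩
  have hx : x = 0 := by simpa [ha] using h
  rw [hx]
  rfl

theorem HasNormalForm.card_zeros [Fintype F] {N s m : ℕ} {A : Matrix (Fin N) (Fin N) F}
    {k a b c : F} (hk : k ≠ 0) (hA : HasNormalForm A s m k a b c) :
    (Nat.card F : ℤ) * Nat.card {x : Fin N → F // x ⬝ᵥ A *ᵥ x = 0} =
      Nat.card ((F × F) × (Fin m → F)) * ((Nat.card F : ℤ) ^ (2 * s) - (Nat.card F : ℤ) ^ s) +
        (Nat.card F : ℤ) ^ (s + 1) * (Nat.card (Fin m → F) *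
          Nat.card {p : F × F // a * p.1 ^ 2 + b * p.1 * p.2 + c * p.2 ^ 2 = 0}) := by
  obtain ⟨e, he⟩ := hA
  let E : ((F × F) × (Fin s → F × F) × (Fin m → F)) ≃ ((F × F) × (Fin m → F)) × (Fin s → F × F) :=
    { toFun := fun w => ((w.1, w.2.2), w.2.1)
      invFun := fun w => (w.1.1, w.2, w.1.2)
      left_inv := fun _ => rfl
      right_inv := fun _ => rfl }
  let g : (F × F) × (Fin m → F) → F := fun w =>
    a * w.1.1 ^ 2 + b * w.1.1 * w.1.2 + c * w.1.2 ^ 2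
  have h1 : {x : Fin N → F // x ⬝ᵥ A *ᵥ x = 0} ≃
      {w : ((F × F) × (Fin m → F)) × (Fin s → F × F) // g w.1 + hypForm w.2 = 0} :=
    (e.toEquiv.trans E).subtypeEquiv fun x => by
      rw [he, mul_eq_zero, or_iff_right hk]
      rfl
  have h2 : {w : (F × F) × (Fin m → F) // g w = 0} ≃
      (Fin m → F) × {p : F × F // a * p.1 ^ 2 + b * p.1 * p.2 + c * p.2 ^ 2 = 0} :=
    { toFun := fun w => (w.1.2, ⟨w.1.1, w.2⟩)
      invFun := fun w => ⟨(w.2.1, w.1), w.2.2⟩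
      left_inv := fun _ => rfl
      right_inv := fun _ => rfl }
  rw [Nat.card_congr h1, card_add_hypForm, Nat.card_congr h2, Nat.card_prod (Fin m → F)]
  push_cast
  rfl

theorem HasNormalForm.isSquare_of_hyperbolic [Fintype F] {N s m : ℕ}
    {A : Matrix (Fin N) (Fin N) F} {k k' a b c : F} (hk : k ≠ 0) (hk' : k' ≠ 0)
    (hA : HasNormalForm A s m k 0 1 0) (hA' : HasNormalForm A s m k' a b c) :
    IsSquare (b ^ 2 - 4 * a * c) := by
  by_contra hd
  have h1 := hA.card_zeros hk
  have h2 := hA'.card_zeros hk'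
  have hF : (Nat.card F : ℤ) ≠ 0 := by exact_mod_cast Nat.card_pos.ne'
  have hm : (Nat.card (Fin m → F) : ℤ) ≠ 0 := by exact_mod_cast Nat.card_pos.ne'
  rw [h1] at h2
  have h3 := mul_left_cancel₀ hm (mul_left_cancel₀ (pow_ne_zero _ hF) (add_left_cancel h2))
  have hs : Subsingleton {p : F × F // a * p.1 ^ 2 + b * p.1 * p.2 + c * p.2 ^ 2 = 0} :=
    ⟨fun p r => Subtype.ext ((eq_zero_of_binary_eq_zero hd p.1 p.2).trans
      (eq_zero_of_binary_eq_zero hd r.1 r.2).symm)⟩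
  have h4 := Finite.card_le_one_iff_subsingleton.2 hs
  rw [← Nat.cast_injective h3, Finite.card_le_one_iff_subsingleton] at h4
  have := h4.elim ⟨((1 : F), (0 : F)), by simp⟩ ⟨((0 : F), (0 : F)), by simp⟩
  simp at this

/-- Completing the square turns the form of a bordered matrix into a binary form plus
hyperbolic planes. -/
def borderCoordEquiv {n s m : ℕ} (e : (Fin n → F) ≃ₗ[F] F × (Fin s → F × F) × (Fin m → F))
    (u : Fin n → F) :
    (Fin (n + 1) → F) ≃ₗ[F] (F × F) × (Fin s → F × F) × (Fin m → F) where
  toFun X := ((X 0, (e (Fin.tail X + X 0 • u)).1), (e (Fin.tail X + X 0 • u)).2)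
  map_add' X Y := by
    have : Fin.tail (X + Y) + (X + Y) 0 • u =
        (Fin.tail X + X 0 • u) + (Fin.tail Y + Y 0 • u) := by
      funext i
      simp [Fin.tail]
      ring
    simp only [this, map_add]
    rfl
  map_smul' k X := by
    have : Fin.tail (k • X) + (k • X) 0 • u = k • (Fin.tail X + X 0 • u) := by
      funext i
      simp [Fin.tail]
      ring
    simp only [this, map_smul]
    rfl
  invFun w := Fin.cons w.1.1 (e.symm (w.1.2, w.2) - w.1.1 • u)
  left_inv X := by
    simp only [Prod.mk.eta, LinearEquiv.symm_apply_apply, add_sub_cancel_right, Fin.cons_self_tail]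
  right_inv w := by simp

/-- The change of variables factoring the binary form `b Y² - (r² / b) X²`. -/
def factorEquiv (h2 : (2 : F) ≠ 0) {b r : F} (hb : b ≠ 0) (hr : r ≠ 0) : (F × F) ≃ₗ[F] F × F where
  toFun p := (b * p.2 - r * p.1, p.2 + r * p.1 / b)
  map_add' p p' := by ext <;> simp <;> ring
  map_smul' k p := by ext <;> simp <;> ring
  invFun p := ((b * p.2 - p.1) / (2 * r), (p.1 + b * p.2) / (2 * b))
  left_inv p := by ext <;> simp <;> field_simp <;> ring
  right_inv p := by ext <;> simp <;> field_simp <;> ring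

section Border

variable {n s m : ℕ} {B : Matrix (Fin n) (Fin n) F}
  {e : (Fin n → F) ≃ₗ[F] F × (Fin s → F × F) × (Fin m → F)} {b : F}

theorem border_hasNormalForm
    (he : ∀ x, x ⬝ᵥ B *ᵥ x = b * (e x).1 ^ 2 + hypForm (e x).2.1) (u : Fin n → F) :
    HasNormalForm (border B u) s m 1 (-(u ⬝ᵥ B *ᵥ u)) 0 b := by
  refine ⟨borderCoordEquiv e u, fun X => ?_⟩
  rw [border_form, he (_ + _)]
  simp only [borderCoordEquiv, LinearEquiv.coe_mk, LinearMap.coe_mk, AddHom.coe_mk]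
  ring

theorem border_hasNormalForm_of_isSquare (h2 : (2 : F) ≠ 0) (hb : b ≠ 0)
    (he : ∀ x, x ⬝ᵥ B *ᵥ x = b * (e x).1 ^ 2 + hypForm (e x).2.1) {u : Fin n → F}
    (hu : u ⬝ᵥ B *ᵥ u ≠ 0) (hsq : IsSquare (b * (u ⬝ᵥ B *ᵥ u))) :
    HasNormalForm (border B u) s m 1 0 1 0 := by
  obtain ⟨r, hr⟩ := hsq
  have hr0 : r ≠ 0 := by
    rintro rfl
    simp [hb, hu] at hr
  have hc : u ⬝ᵥ B *ᵥ u = r ^ 2 / b := by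
    field_simp
    linear_combination hr
  obtain ⟨E, hE⟩ := border_hasNormalForm he u
  refine ⟨E.trans ((factorEquiv h2 hb hr0).prodCongr (LinearEquiv.refl F _)), fun X => ?_⟩
  rw [hE, hc]
  simp [factorEquiv]
  field_simp
  ring

theorem isHyp_border_iff [Fintype F] (h2 : (2 : F) ≠ 0) (hn : n = 2 * s + 1 + m) (hb : b ≠ 0)
    (he : ∀ x, x ⬝ᵥ B *ᵥ x = b * (e x).1 ^ 2 + hypForm (e x).2.1) {u : Fin n → F}
    (hu : u ⬝ᵥ B *ᵥ u ≠ 0) :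
    IsHyp (border B u) (s + 1) ↔ IsSquare (b * (u ⬝ᵥ B *ᵥ u)) := by
  have hN : n + 1 = 2 + (s * 2 + m) := by omega
  simp only [IsHyp, stdHyp_eq_stdEll, quadEquiv_stdEll_iff hN]
  constructor
  · rintro ⟨k, hk, h⟩
    obtain ⟨r, hr⟩ := h.isSquare_of_hyperbolic hk one_ne_zero (border_hasNormalForm he u)
    refine ⟨r / 2, ?_⟩
    field_simp
    linear_combination hr
  · intro h
    exact ⟨1, one_ne_zero, border_hasNormalForm_of_isSquare h2 hb he hu h⟩

theorem isEll_border_iff [Fintype F] (h2 : (2 : F) ≠ 0) (hn : n = 2 * s + 1 + m) (hb : b ≠ 0)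
    (he : ∀ x, x ⬝ᵥ B *ᵥ x = b * (e x).1 ^ 2 + hypForm (e x).2.1) {u : Fin n → F}
    (hu : u ⬝ᵥ B *ᵥ u ≠ 0) :
    IsEll (border B u) (s + 1) ↔ ¬ IsSquare (b * (u ⬝ᵥ B *ᵥ u)) := by
  have hN : n + 1 = 2 + (s * 2 + m) := by omega
  simp only [IsEll, quadEquiv_stdEll_iff hN]
  constructor
  · rintro ⟨k, a, b', c, hk, hd, h⟩ hsq
    exact hd ((border_hasNormalForm_of_isSquare h2 hb he hu hsq).isSquare_of_hyperbolic
      one_ne_zero hk h)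
  · intro h
    refine ⟨1, _, 0, b, one_ne_zero, fun ⟨r, hr⟩ => h ⟨r / 2, ?_⟩, border_hasNormalForm he u⟩
    field_simp
    linear_combination hr

/-- Bordered matrices correspond to the non-isotropic vectors modulo the radical. -/
theorem card_bordered (h2 : (2 : F) ≠ 0) (hB : B.IsSymm) (hb : b ≠ 0)
    (he : ∀ x, x ⬝ᵥ B *ᵥ x = b * (e x).1 ^ 2 + hypForm (e x).2.1)
    (hr : B.rank = 2 * s + 1) (P : Matrix (Fin (n + 1)) (Fin (n + 1)) F → Prop) (R : F → Prop)
    (hPR : ∀ u : Fin n → F, u ⬝ᵥ B *ᵥ u ≠ 0 → (P (border B u) ↔ R (u ⬝ᵥ B *ᵥ u))) :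
    Nat.card {A : Matrix (Fin (n + 1)) (Fin (n + 1)) F //
        A.IsSymm ∧ A 0 0 = 0 ∧ A.submatrix Fin.succ Fin.succ = B ∧
        (∃ u : Fin n → F, (∀ j : Fin n, A 0 j.succ = Matrix.vecMul u B j) ∧
          u ⬝ᵥ B.mulVec u ≠ 0) ∧
        A.rank = 2 * (s + 1) ∧ P A} =
      Nat.card {p : F × (Fin s → F × F) // b * p.1 ^ 2 + hypForm p.2 ≠ 0 ∧
        R (b * p.1 ^ 2 + hypForm p.2)} := by
  let ι : F × (Fin s → F × F) → Fin n → F := fun p => e.symm (p.1, p.2, 0)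
  have hι : ∀ p, ι p ⬝ᵥ B *ᵥ ι p = b * p.1 ^ 2 + hypForm p.2 := fun p => by simp [he, ι]
  have hrad : ∀ d, B *ᵥ d = 0 ↔ ((e d).1, (e d).2.1) = 0 := by
    intro d
    rw [mulVec_eq_zero_iff_forall_add h2 hB, ← parabolic_radical h2 hb]
    constructor
    · intro h x
      have := h (ι x)
      simpa [he, ι] using this
    · intro h x
      have := h ((e x).1, (e x).2.1)
      simpa [he] using this
  have hsub : ∀ u v : Fin n → F, B *ᵥ u = B *ᵥ v ↔
      ((e u).1, (e u).2.1) = ((e v).1, (e v).2.1) := by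
    intro u v
    rw [← sub_eq_zero, ← mulVec_sub, hrad, map_sub, ← sub_eq_zero (b := ((e v).1, (e v).2.1))]
    rfl
  have hvm : ∀ u : Fin n → F, u ᵥ* B = B *ᵥ u := fun u => by rw [← mulVec_transpose, hB.eq]
  have hmem : ∀ p : {p : F × (Fin s → F × F) // b * p.1 ^ 2 + hypForm p.2 ≠ 0 ∧
      R (b * p.1 ^ 2 + hypForm p.2)},
      (border B (ι p.1)).IsSymm ∧ border B (ι p.1) 0 0 = 0 ∧
        (border B (ι p.1)).submatrix Fin.succ Fin.succ = B ∧
        (∃ u : Fin n → F, (∀ j : Fin n, border B (ι p.1) 0 j.succ = Matrix.vecMul u B j) ∧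
          u ⬝ᵥ B.mulVec u ≠ 0) ∧
        (border B (ι p.1)).rank = 2 * (s + 1) ∧ P (border B (ι p.1)) := by
    rintro ⟨p, hp, hR⟩
    rw [← hι] at hp hR
    refine ⟨border_isSymm hB _, rfl, rfl, ⟨ι p, fun j => rfl, hp⟩, ?_, (hPR _ hp).2 hR⟩
    rw [rank_border hp, hr]
    ring
  refine (Nat.card_congr (Equiv.ofBijective (fun p => ⟨border B (ι p.1), hmem p⟩) ⟨?_, ?_⟩)).symm
  · rintro ⟨p, hp⟩ ⟨p', hp'⟩ h
    have h := congrArg Subtype.val h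
    have h1 : B *ᵥ ι p = B *ᵥ ι p' := by
      rw [← hvm, ← hvm]
      exact funext fun j => congrFun (congrFun h 0) j.succ
    rw [hsub] at h1
    exact Subtype.ext (by simpa [ι] using h1)
  · rintro ⟨A, hA, h0, hAB, ⟨u, huA, hu⟩, hrk, hP⟩
    have hAu : A = border B u := by
      ext i j
      refine Fin.cases ?_ (fun i => ?_) i <;> refine Fin.cases ?_ (fun j => ?_) j
      · exact h0
      · exact huA j
      · rw [hA.apply, huA, hvm]
        rfl
      · exact congrFun (congrFun hAB i) j
    have h1 : B *ᵥ ι ((e u).1, (e u).2.1) = B *ᵥ u := by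
      rw [hsub]
      simp [ι]
    have h3 : border B (ι ((e u).1, (e u).2.1)) = border B u := by
      simp only [border, hvm, h1]
    have hR := (hPR u hu).1 (hAu ▸ hP)
    rw [he u] at hu hR
    exact ⟨⟨((e u).1, (e u).2.1), hu, hR⟩, Subtype.ext (h3.trans hAu.symm)⟩

end Border

theorem card_sq_eq_sq (h2 : (2 : F) ≠ 0) {r : F} (hr : r ≠ 0) :
    Nat.card {y : F // y ^ 2 = r ^ 2} = 2 := by
  have h : {y : F | y ^ 2 = r ^ 2} = {r, -r} := by
    ext y
    simp [sq_eq_sq_iff_eq_or_eq_neg]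
  have hne : r ≠ -r := fun h => by
    have : 2 * r = 0 := by linear_combination h
    simp [h2, hr] at this
  change Nat.card {y : F | y ^ 2 = r ^ 2} = 2
  rw [h, Nat.card_coe_set_eq, Set.ncard_pair hne]

theorem card_and_add_card_and_not {α : Type*} [Finite α] (p r : α → Prop) :
    Nat.card {x // p x ∧ r x} + Nat.card {x // p x ∧ ¬ r x} = Nat.card {x // p x} := by
  classical
  have := Fintype.ofFinite α
  simp only [Nat.card_eq_fintype_card, Fintype.card_subtype, ← Finset.filter_filter]
  exact Finset.card_filter_add_card_filter_not _

section ParabolicCount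

variable [Fintype F] {b : F} (s : ℕ)

theorem two_mul_card_parabolic_isSquare (h2 : (2 : F) ≠ 0) (hb : b ≠ 0) :
    (2 : ℤ) * Nat.card {p : F × (Fin s → F × F) // b * p.1 ^ 2 + hypForm p.2 ≠ 0 ∧
        IsSquare (b * (b * p.1 ^ 2 + hypForm p.2))} =
      (Nat.card F - 1) * ((Nat.card F : ℤ) ^ (2 * s) + (Nat.card F : ℤ) ^ s) := by
  classical
  let q : F × (Fin s → F × F) → F := fun p => b * p.1 ^ 2 + hypForm p.2
  have hcount := card_add_hypForm s
    (fun w : F × {k : F // k ≠ 0} => b * w.1 ^ 2 - b * w.2.1 ^ 2)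
  have hunits : (Nat.card {k : F // k ≠ 0} : ℤ) = Nat.card F - 1 := by
    rw [← Nat.card_congr (unitsEquivNeZero (G₀ := F)), Nat.card_units,
      Nat.cast_sub Nat.card_pos, Nat.cast_one]
  have hzeros : Nat.card {w : F × {k : F // k ≠ 0} // b * w.1 ^ 2 - b * w.2.1 ^ 2 = 0} =
      Nat.card {k : F // k ≠ 0} * 2 := by
    let E : {w : F × {k : F // k ≠ 0} // b * w.1 ^ 2 - b * w.2.1 ^ 2 = 0} ≃
        Σ k : {k : F // k ≠ 0}, {y : F // y ^ 2 = k.1 ^ 2} :=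
      { toFun := fun w => ⟨w.1.2, w.1.1, mul_left_cancel₀ hb (sub_eq_zero.1 w.2)⟩
        invFun := fun w => ⟨(w.2.1, w.1), by rw [w.2.2, sub_self]⟩
        left_inv := fun _ => rfl
        right_inv := fun _ => rfl }
    rw [Nat.card_congr E, Nat.card_sigma, Finset.sum_congr rfl fun k _ => card_sq_eq_sq h2 k.2]
    simp
  have hroots : Nat.card {x : (F × {k : F // k ≠ 0}) × (Fin s → F × F) //
      b * x.1.1 ^ 2 - b * x.1.2.1 ^ 2 + hypForm x.2 = 0} =
      Nat.card {p // q p ≠ 0 ∧ IsSquare (b * q p)} * 2 := by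
    let E : {x : (F × {k : F // k ≠ 0}) × (Fin s → F × F) //
        b * x.1.1 ^ 2 - b * x.1.2.1 ^ 2 + hypForm x.2 = 0} ≃
        Σ p : {p // q p ≠ 0 ∧ IsSquare (b * q p)}, {k : F // b * k ^ 2 = q p.1} :=
      { toFun := fun x =>
          have h : b * x.1.1.2.1 ^ 2 = q (x.1.1.1, x.1.2) := by
            have := x.2
            simp only [q]
            linear_combination -this
          ⟨⟨(x.1.1.1, x.1.2), by
            rw [← h]
            exact ⟨mul_ne_zero hb (pow_ne_zero _ x.1.1.2.2), b * x.1.1.2.1, by ring⟩⟩,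
            x.1.1.2.1, h⟩
        invFun := fun w => ⟨((w.1.1.1, ⟨w.2.1, fun h => w.1.2.1 (by
            rw [← w.2.2, h]
            ring)⟩), w.1.1.2), by
          have := w.2.2
          simp only [q] at this
          linear_combination -this⟩
        left_inv := fun _ => rfl
        right_inv := fun _ => rfl }
    have hfib : ∀ p : {p // q p ≠ 0 ∧ IsSquare (b * q p)},
        Nat.card {k : F // b * k ^ 2 = q p.1} = 2 := by
      rintro ⟨p, hp, r, hr⟩
      have hr0 : r ≠ 0 := by
        rintro rfl
        simp [hb, hp] at hr
      refine (Nat.card_congr (Equiv.subtypeEquivRight fun k => ?_)).trans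
        (card_sq_eq_sq h2 (div_ne_zero hr0 hb))
      have : q p = b * (r / b) ^ 2 := by
        field_simp
        linear_combination hr
      rw [this]
      exact mul_right_inj' hb
    rw [Nat.card_congr E, Nat.card_sigma, Finset.sum_congr rfl fun p _ => hfib p]
    simp
  rw [hroots, hzeros, Nat.card_prod] at hcount
  push_cast at hcount
  rw [hunits] at hcount
  have hF : (Nat.card F : ℤ) ≠ 0 := by exact_mod_cast Nat.card_pos.ne'
  refine mul_left_cancel₀ hF ?_
  linear_combination hcount

theorem card_parabolic_ne_zero (hb : b ≠ 0) :
    (Nat.card {p : F × (Fin s → F × F) // b * p.1 ^ 2 + hypForm p.2 ≠ 0} : ℤ) =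
      (Nat.card F - 1) * (Nat.card F : ℤ) ^ (2 * s) := by
  have hcount := card_add_hypForm s (fun y : F => b * y ^ 2)
  have hzero : Nat.card {y : F // b * y ^ 2 = 0} = 1 := by
    rw [Nat.card_eq_one_iff_unique]
    exact ⟨⟨fun y z => Subtype.ext (by
      have hy := y.2
      have hz := z.2
      simp only [mul_eq_zero, hb, false_or, sq_eq_zero_iff] at hy hz
      rw [hy, hz])⟩, ⟨0, by simp⟩⟩
  have htotal := card_and_add_card_and_not (fun _ : F × (Fin s → F × F) => True)
    (fun p => b * p.1 ^ 2 + hypForm p.2 = 0)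
  simp only [true_and] at htotal
  have hall : Nat.card {_p : F × (Fin s → F × F) // True} = Nat.card F * Nat.card F ^ (2 * s) := by
    rw [Nat.card_congr (Equiv.subtypeUnivEquiv fun _ => trivial), Nat.card_prod, Nat.card_fun]
    simp [pow_mul, sq]
  rw [hall] at htotal
  have htotal := congrArg (Nat.cast : ℕ → ℤ) htotal
  push_cast at htotal
  rw [hzero] at hcount
  have hF : (Nat.card F : ℤ) ≠ 0 := by exact_mod_cast Nat.card_pos.ne'
  refine mul_left_cancel₀ hF ?_
  linear_combination (Nat.card F : ℤ) * htotal - hcount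

end ParabolicCount

end OddCharacteristic


/-- Let `B` be symmetric of odd rank `2t − 1`. Among the symmetric bordered matrices
`A = [[0, u B], [B uᵀ, B]]` of rank `2t` (equivalently with `u B uᵀ ≠ 0`), exactly
`((q−1)/2) q^{t−1}(q^{t−1}+1)` are hyperbolic and exactly `((q−1)/2) q^{t−1}(q^{t−1}−1)` are
elliptic. -/
theorem border_odd_rank_counts (F : Type*) [Field F] [Fintype F] (hq : Odd (Fintype.card F))
    (n t : ℕ) (ht : 1 ≤ t)
    (B : Matrix (Fin n) (Fin n) F) (hB : B.IsSymm) (hr : B.rank = 2 * t - 1) :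
    (Nat.card {A : Matrix (Fin (n + 1)) (Fin (n + 1)) F //
        A.IsSymm ∧ A 0 0 = 0 ∧ A.submatrix Fin.succ Fin.succ = B ∧
        (∃ u : Fin n → F, (∀ j : Fin n, A 0 j.succ = Matrix.vecMul u B j) ∧
          u ⬝ᵥ B.mulVec u ≠ 0) ∧
        A.rank = 2 * t ∧ IsHyp A t} : ℚ) =
      ((Fintype.card F : ℚ) - 1) / 2 * (Fintype.card F : ℚ) ^ (t - 1) *
        ((Fintype.card F : ℚ) ^ (t - 1) + 1) ∧
    (Nat.card {A : Matrix (Fin (n + 1)) (Fin (n + 1)) F //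
        A.IsSymm ∧ A 0 0 = 0 ∧ A.submatrix Fin.succ Fin.succ = B ∧
        (∃ u : Fin n → F, (∀ j : Fin n, A 0 j.succ = Matrix.vecMul u B j) ∧
          u ⬝ᵥ B.mulVec u ≠ 0) ∧
        A.rank = 2 * t ∧ IsEll A t} : ℚ) =
      ((Fintype.card F : ℚ) - 1) / 2 * (Fintype.card F : ℚ) ^ (t - 1) *
        ((Fintype.card F : ℚ) ^ (t - 1) - 1) := by
  have h2 : (2 : F) ≠ 0 := Ring.two_ne_zero fun h => by
    have := FiniteField.even_card_of_char_two h
    rw [Nat.odd_iff] at hq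
    omega
  obtain ⟨s, rfl⟩ : ∃ s, t = s + 1 := ⟨t - 1, by omega⟩
  have hr' : B.rank = 2 * s + 1 := by omega
  obtain ⟨m, e, b, hn, hb, he⟩ := exists_parabolic_normal_form hq h2 hB hr'
  rw [card_bordered h2 hB hb he hr' _ (fun c => IsSquare (b * c))
      fun u hu => isHyp_border_iff h2 hn hb he hu,
    card_bordered h2 hB hb he hr' _ (fun c => ¬ IsSquare (b * c))
      fun u hu => isEll_border_iff h2 hn hb he hu,
    ← Nat.card_eq_fintype_card, Nat.add_sub_cancel]
  have hsq := congrArg (Int.cast : ℤ → ℚ) (two_mul_card_parabolic_isSquare s h2 hb)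
  have hne := congrArg (Int.cast : ℤ → ℚ) (card_parabolic_ne_zero s hb)
  rw [← card_and_add_card_and_not _
    (fun p : F × (Fin s → F × F) => IsSquare (b * (b * p.1 ^ 2 + hypForm p.2)))] at hne
  push_cast at hsq hne
  constructor
  · linear_combination hsq / 2
  · linear_combination hne - hsq / 2
end
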